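/- arXiv:1905.05745 — 3 statements merged into one kernel-verified Lean document; each statement's English description precedes it below -/
import Mathlib

section
/- Let q be an odd prime power and f(t) ∈ F_q[t] a monic irreducible polynomial. Then there exists a monic irreducible polynomial d(t) ∈ F_q[t] with deg(d) of opposite parity to deg(f) such that for every nonsquare g ∈ F_q, the residue of g·d(t) in F_q[t]/(f(t)) is a nonsquare. -/
open Polynomial
noncomputable section

namespace FFDir

set_option linter.unusedSectionVars false
variable {F : Type} [Field F] [Fintype F]

open scoped Classical in
/-- monic polynomials of degree `N` -/
def M (F : Type) [Field F] [Fintype F] : ℕ → Finset F[X]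
  | 0 => {1}
  | N + 1 => ((M F N) ×ˢ (Finset.univ : Finset F)).image (fun x => X * x.1 + C x.2)

lemma mem_M (N : ℕ) (h : F[X]) : h ∈ M F N ↔ h.Monic ∧ h.natDegree = N := by
  induction N generalizing h with
  | zero =>
    simp only [M, Finset.mem_singleton]
    constructor
    · rintro rfl; simp
    · rintro ⟨h1, h2⟩; exact h1.natDegree_eq_zero.mp h2
  | succ N ih =>
    simp only [M, Finset.mem_image, Finset.mem_product, Finset.mem_univ, and_true, Prod.exists]
    constructor
    · rintro ⟨a, c, ha, rfl⟩
      obtain ⟨h1, h2⟩ := (ih a).1 ha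
      have hx : (X * a).Monic := monic_X.mul h1
      have hd : (X * a).natDegree = N + 1 := by
        rw [monic_X.natDegree_mul h1, h2, natDegree_X, add_comm]
      have hlt : (C c).degree < (X * a).degree := by
        rw [degree_eq_natDegree hx.ne_zero, hd]
        refine lt_of_le_of_lt degree_C_le ?_
        exact_mod_cast Nat.succ_pos N
      refine ⟨hx.add_of_left hlt, ?_⟩
      rw [natDegree_add_C, hd]
    · rintro ⟨h1, h2⟩
      refine ⟨h.divX, h.coeff 0, (ih _).2 ⟨?_, ?_⟩, ?_⟩
      · rw [Monic, leadingCoeff, natDegree_divX_eq_natDegree_tsub_one, coeff_divX, h2,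
          Nat.add_sub_cancel, ← h2]
        exact h1
      · rw [natDegree_divX_eq_natDegree_tsub_one, h2, Nat.add_sub_cancel]
      · rw [X_mul]; exact divX_mul_X_add h

lemma card_M (N : ℕ) : (M F N).card = Fintype.card F ^ N := by
  induction N with
  | zero => simp [M]
  | succ N ih =>
    classical
    rw [M, Finset.card_image_of_injective, Finset.card_product, ih, pow_succ, Finset.card_univ]
    rintro ⟨a, c⟩ ⟨a', c'⟩ h
    have h0 := congrArg (fun p : F[X] => p.coeff 0) h
    simp at h0
    subst h0
    simp at h
    simp [h]

open scoped Classical in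
/-- monic factorizations `h = a * b` -/
def D (h : F[X]) : Finset (F[X] × F[X]) :=
  (((Finset.range (h.natDegree + 1)).biUnion (M F)) ×ˢ
    ((Finset.range (h.natDegree + 1)).biUnion (M F))).filter (fun x => x.1 * x.2 = h)

lemma mem_D (h : F[X]) (x : F[X] × F[X]) :
    x ∈ D h ↔ x.1.Monic ∧ x.2.Monic ∧ x.1 * x.2 = h := by
  simp only [D, Finset.mem_filter, Finset.mem_product, Finset.mem_biUnion, Finset.mem_range, mem_M]
  constructor
  · rintro ⟨⟨⟨_, _, h1, _⟩, ⟨_, _, h2, _⟩⟩, h3⟩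
    exact ⟨h1, h2, h3⟩
  · rintro ⟨h1, h2, h3⟩
    have : x.1.natDegree + x.2.natDegree = h.natDegree := by
      rw [← h3, h1.natDegree_mul h2]
    exact ⟨⟨⟨_, by omega, h1, rfl⟩, ⟨_, by omega, h2, rfl⟩⟩, h3⟩

/-- Dirichlet convolution -/
def conv (g k : F[X] → ℤ) (h : F[X]) : ℤ := ∑ x ∈ D h, g x.1 * k x.2

/-- multiplicative functions on monic polynomials -/
def Mult (g : F[X] → ℤ) : Prop :=
  g 1 = 1 ∧ ∀ a b : F[X], a.Monic → b.Monic → IsCoprime a b → g (a * b) = g a * g b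

lemma D_one : D (1 : F[X]) = {(1, 1)} := by
  ext ⟨a, b⟩
  rw [mem_D]
  simp only [Finset.mem_singleton, Prod.mk.injEq]
  constructor
  · rintro ⟨h1, h2, h3⟩
    have : a.natDegree + b.natDegree = 0 := by
      rw [← h1.natDegree_mul h2, h3, natDegree_one]
    exact ⟨h1.natDegree_eq_zero.mp (by omega), h2.natDegree_eq_zero.mp (by omega)⟩
  · rintro ⟨rfl, rfl⟩; simp

lemma eq_of_dvd_dvd {a b : F[X]} (ha : a.Monic) (hb : b.Monic) (h1 : a ∣ b) (h2 : b ∣ a) : a = b :=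
  eq_of_monic_of_associated ha hb (associated_of_dvd_dvd h1 h2)

lemma dvd_of_prod {a c a' c' x y : F[X]} (h : IsCoprime x y) (ha : a ∣ x) (hc : c' ∣ y)
    (he : a * c = a' * c') : a ∣ a' := by
  have : IsCoprime a c' := (h.of_isCoprime_of_dvd_left ha).of_isCoprime_of_dvd_right hc
  exact this.dvd_of_dvd_mul_right (he ▸ dvd_mul_right a c)

lemma exists_monic_assoc {a : F[X]} (ha : a ≠ 0) : ∃ b : F[X], b.Monic ∧ Associated a b := by
  classical
  exact ⟨normalize a, monic_normalize ha, (normalize_associated a).symm⟩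

lemma conv_mult {g k : F[X] → ℤ} (hg : Mult g) (hk : Mult k) : Mult (conv g k) := by
  refine ⟨by simp [conv, D_one, hg.1, hk.1], ?_⟩
  intro x y hx hy hc
  rw [conv, conv, conv, Finset.sum_mul_sum, ← Finset.sum_product']
  symm
  refine Finset.sum_nbij (fun z => (z.1.1 * z.2.1, z.1.2 * z.2.2)) ?_ ?_ ?_ ?_
  · rintro ⟨⟨a, b⟩, ⟨c, d⟩⟩ h
    simp only [Finset.mem_product, mem_D] at h ⊢
    obtain ⟨⟨h1, h2, h3⟩, h4, h5, h6⟩ := h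
    refine ⟨h1.mul h4, h2.mul h5, ?_⟩
    rw [← h3, ← h6]; ring
  · rintro ⟨⟨a, b⟩, ⟨c, d⟩⟩ h ⟨⟨a', b'⟩, ⟨c', d'⟩⟩ h' he
    simp only [Finset.mem_coe, Finset.mem_product, mem_D] at h h'
    obtain ⟨⟨h1, h2, h3⟩, h4, h5, h6⟩ := h
    obtain ⟨⟨h1', h2', h3'⟩, h4', h5', h6'⟩ := h'
    simp only [Prod.mk.injEq] at he
    have a1 : a ∣ x := ⟨b, h3.symm⟩
    have a2 : a' ∣ x := ⟨b', h3'.symm⟩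
    have c1 : c ∣ y := ⟨d, h6.symm⟩
    have c2 : c' ∣ y := ⟨d', h6'.symm⟩
    have ea : a = a' := eq_of_dvd_dvd h1 h1' (dvd_of_prod hc a1 c2 he.1)
      (dvd_of_prod hc a2 c1 he.1.symm)
    have ec : c = c' := by
      have := he.1
      rw [ea] at this
      exact mul_left_cancel₀ h1'.ne_zero this
    subst ea ec
    have eb : b = b' := mul_left_cancel₀ h1.ne_zero (h3.trans h3'.symm)
    have ed : d = d' := mul_left_cancel₀ h4.ne_zero (h6.trans h6'.symm)
    rw [eb, ed]
  · rintro ⟨u, v⟩ h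
    simp only [Finset.mem_coe, mem_D] at h
    obtain ⟨h1, h2, h3⟩ := h
    obtain ⟨a0, c0, ha0, hc0, hac⟩ := exists_dvd_and_dvd_of_dvd_mul (⟨v, h3.symm⟩ : u ∣ x * y)
    have n0 : a0 ≠ 0 := by rintro rfl; exact h1.ne_zero (by simp [hac])
    have n1 : c0 ≠ 0 := by rintro rfl; exact h1.ne_zero (by simp [hac])
    obtain ⟨a, ma, aa⟩ := exists_monic_assoc n0
    obtain ⟨c, mc, ac⟩ := exists_monic_assoc n1
    obtain ⟨b, hb⟩ := aa.dvd_iff_dvd_left.1 ha0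
    obtain ⟨d, hd⟩ := ac.dvd_iff_dvd_left.1 hc0
    have mb : b.Monic := ma.of_mul_monic_left (hb ▸ hx)
    have md : d.Monic := mc.of_mul_monic_left (hd ▸ hy)
    have hu : u = a * c := eq_of_monic_of_associated h1 (ma.mul mc) (hac ▸ aa.mul_mul ac)
    have hv : v = b * d := by
      apply mul_left_cancel₀ h1.ne_zero
      rw [h3, hb, hd, hu]; ring
    refine ⟨((a, b), (c, d)), ?_, by simp [hu, hv]⟩
    simp only [Finset.mem_coe, Finset.mem_product, mem_D]
    exact ⟨⟨ma, mb, hb.symm⟩, mc, md, hd.symm⟩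
  · rintro ⟨⟨a, b⟩, ⟨c, d⟩⟩ h
    simp only [Finset.mem_product, mem_D] at h
    obtain ⟨⟨h1, h2, h3⟩, h4, h5, h6⟩ := h
    have a1 : a ∣ x := ⟨b, h3.symm⟩
    have b1 : b ∣ x := ⟨a, by rw [← h3, mul_comm]⟩
    have c1 : c ∣ y := ⟨d, h6.symm⟩
    have d1 : d ∣ y := ⟨c, by rw [← h6, mul_comm]⟩
    have q1 : IsCoprime a c := (hc.of_isCoprime_of_dvd_left a1).of_isCoprime_of_dvd_right c1
    have q2 : IsCoprime b d := (hc.of_isCoprime_of_dvd_left b1).of_isCoprime_of_dvd_right d1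
    simp only
    rw [hg.2 a c h1 h4 q1, hk.2 b d h2 h5 q2]
    ring

/-- local series -/
def loc (p : F[X]) (g : F[X] → ℤ) : PowerSeries ℤ := PowerSeries.mk fun k => g (p ^ k)

/-- global series -/
def gs (g : F[X] → ℤ) : PowerSeries ℤ := PowerSeries.mk fun N => ∑ h ∈ M F N, g h

lemma loc_conv {p : F[X]} (hp : p.Monic) (hi : Irreducible p) (g k : F[X] → ℤ) :
    loc p (conv g k) = loc p g * loc p k := by
  ext n
  simp only [loc, PowerSeries.coeff_mul, PowerSeries.coeff_mk, conv]
  symm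
  refine Finset.sum_nbij (fun z => (p ^ z.1, p ^ z.2)) ?_ ?_ ?_ ?_
  · rintro ⟨i, j⟩ h
    simp only [Finset.HasAntidiagonal.mem_antidiagonal, mem_D] at h ⊢
    exact ⟨hp.pow _, hp.pow _, by rw [← pow_add, h]⟩
  · rintro ⟨i, j⟩ h ⟨i', j'⟩ h' he
    simp only [Prod.mk.injEq] at he ⊢
    have hd : 0 < p.natDegree := hi.natDegree_pos
    have key : ∀ i i', p ^ i = p ^ i' → i = i' := by
      intro i i' e
      have := congrArg natDegree e
      rw [hp.natDegree_pow, hp.natDegree_pow] at this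
      exact Nat.eq_of_mul_eq_mul_right hd this
    exact ⟨key _ _ he.1, key _ _ he.2⟩
  · rintro ⟨u, v⟩ h
    simp only [Finset.mem_coe, mem_D] at h
    obtain ⟨h1, h2, h3⟩ := h
    obtain ⟨i, hin, hu⟩ := (dvd_prime_pow hi.prime n).1 (⟨v, h3.symm⟩ : u ∣ p ^ n)
    have hu' := eq_of_monic_of_associated h1 (hp.pow i) hu
    refine ⟨(i, n - i), by simp; omega, ?_⟩
    simp only [Prod.mk.injEq]
    refine ⟨hu'.symm, ?_⟩
    apply mul_left_cancel₀ h1.ne_zero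
    rw [h3, hu', ← pow_add]
    congr 1; omega
  · rintro ⟨i, j⟩ h
    rfl

lemma gs_conv (g k : F[X] → ℤ) : gs (conv g k) = gs g * gs k := by
  ext n
  simp only [gs, PowerSeries.coeff_mul, PowerSeries.coeff_mk, conv]
  simp_rw [Finset.sum_mul_sum, ← Finset.sum_product']
  rw [Finset.sum_sigma', Finset.sum_sigma']
  refine Finset.sum_nbij' (fun z => ⟨(z.2.1.natDegree, z.2.2.natDegree), z.2⟩)
    (fun z => ⟨z.2.1 * z.2.2, z.2⟩) ?_ ?_ ?_ ?_ ?_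
  · rintro ⟨h, ⟨a, b⟩⟩ hh
    simp only [Finset.mem_sigma, mem_D, mem_M, Finset.HasAntidiagonal.mem_antidiagonal, Finset.mem_product] at hh ⊢
    obtain ⟨⟨h1, h2⟩, h3, h4, h5⟩ := hh
    exact ⟨by rw [← h2, ← h5, h3.natDegree_mul h4], ⟨h3, trivial⟩, h4, trivial⟩
  · rintro ⟨⟨i, j⟩, ⟨a, b⟩⟩ hh
    simp only [Finset.mem_sigma, mem_D, mem_M, Finset.HasAntidiagonal.mem_antidiagonal, Finset.mem_product] at hh ⊢
    obtain ⟨h1, ⟨h2, h3⟩, h4, h5⟩ := hh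
    exact ⟨⟨h2.mul h4, by rw [h2.natDegree_mul h4, h3, h5, h1]⟩, h2, h4, trivial⟩
  · rintro ⟨h, ⟨a, b⟩⟩ hh
    simp only [Finset.mem_sigma, mem_D, mem_M] at hh
    simp [hh.2.2.2]
  · rintro ⟨⟨i, j⟩, ⟨a, b⟩⟩ hh
    simp only [Finset.mem_sigma, mem_M, Finset.HasAntidiagonal.mem_antidiagonal, Finset.mem_product] at hh
    obtain ⟨h1, ⟨h2, h3⟩, h4, h5⟩ := hh
    simp [h3, h5]
  · rintro ⟨h, ⟨a, b⟩⟩ hh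
    rfl

lemma mon_induction (P : F[X] → Prop) (h1 : P 1)
    (hp : ∀ p : F[X], p.Monic → Irreducible p → ∀ k, P (p ^ k))
    (hm : ∀ a b : F[X], a.Monic → b.Monic → IsCoprime a b → P a → P b → P (a * b))
    (h : F[X]) (hh : h.Monic) : P h := by
  classical
  have key : ∀ x : F[X], x ≠ 0 → P (normalize x) := by
    intro x
    induction x using UniqueFactorizationMonoid.induction_on_coprime with
    | h0 => simp
    | h1 hu => intro _; rw [normalize_eq_one.2 hu]; exact h1
    | hpr i hq =>
      intro _
      have hnp : ∀ (p : F[X]) (i : ℕ), normalize (p ^ i) = normalize p ^ i := by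
        intro p i
        induction i with
        | zero => simp
        | succ i ih => rw [pow_succ, pow_succ, normalize_mul, ih]
      rw [hnp]
      exact hp _ (monic_normalize hq.ne_zero)
        ((normalize_associated _).symm.irreducible hq.irreducible) i
    | hcp hxy ha hb =>
      intro hn
      rw [normalize_mul]
      have n1 := left_ne_zero_of_mul hn
      have n2 := right_ne_zero_of_mul hn
      refine hm _ _ (monic_normalize n1) (monic_normalize n2) ?_ (ha n1) (hb n2)
      exact (hxy.isCoprime.of_isCoprime_of_dvd_left (normalize_associated _).dvd).of_isCoprime_of_dvd_right (normalize_associated _).dvd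
  have := key h hh.ne_zero
  rwa [hh.normalize_eq_self] at this

lemma mult_ext {g k : F[X] → ℤ} (hg : Mult g) (hk : Mult k)
    (hl : ∀ p : F[X], p.Monic → Irreducible p → loc p g = loc p k) (h : F[X]) (hh : h.Monic) :
    g h = k h := by
  refine mon_induction (fun h => g h = k h) (hg.1.trans hk.1.symm) ?_ ?_ h hh
  · intro p hp hi n
    have := congrArg (PowerSeries.coeff n) (hl p hp hi)
    simpa [loc] using this
  · intro a b ha hb hc e1 e2
    rw [hg.2 a b ha hb hc, hk.2 a b ha hb hc, e1, e2]

lemma gs_congr {g k : F[X] → ℤ} (h : ∀ x : F[X], x.Monic → g x = k x) : gs g = gs k := by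
  ext n
  simp only [gs, PowerSeries.coeff_mk]
  exact Finset.sum_congr rfl fun x hx => h x ((mem_M _ _).1 hx).1


/-- completely multiplicative functions -/
def CMult (g : F[X] → ℤ) : Prop := g 1 = 1 ∧ ∀ a b : F[X], a ≠ 0 → b ≠ 0 → g (a * b) = g a * g b

lemma CMult.mult {g : F[X] → ℤ} (hg : CMult g) : Mult g :=
  ⟨hg.1, fun a b ha hb _ => hg.2 a b ha.ne_zero hb.ne_zero⟩

lemma CMult.mul {g k : F[X] → ℤ} (hg : CMult g) (hk : CMult k) : CMult (fun h => g h * k h) := by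
  refine ⟨by simp [hg.1, hk.1], fun a b ha hb => ?_⟩
  simp only [hg.2 a b ha hb, hk.2 a b ha hb]
  ring

lemma CMult.pow {g : F[X] → ℤ} (hg : CMult g) {p : F[X]} (hp : p ≠ 0) (k : ℕ) :
    g (p ^ k) = g p ^ k := by
  induction k with
  | zero => simp [hg.1]
  | succ k ih => rw [pow_succ, pow_succ, hg.2 _ _ (pow_ne_zero _ hp) hp, ih]

lemma geom (c : ℤ) :
    (PowerSeries.mk fun k => c ^ k) * (1 - PowerSeries.C c * PowerSeries.X) = 1 := by
  ext n
  cases n with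
  | zero => simp
  | succ n =>
    rw [mul_sub, mul_one, mul_comm (PowerSeries.C c), ← mul_assoc, map_sub,
      PowerSeries.coeff_mul_C, PowerSeries.coeff_succ_mul_X, PowerSeries.coeff_mk,
      PowerSeries.coeff_mk, PowerSeries.coeff_one]
    simp [pow_succ]

lemma loc_cm {g : F[X] → ℤ} (hg : CMult g) {p : F[X]} (hp : p ≠ 0) :
    loc p g * (1 - PowerSeries.C (g p) * PowerSeries.X) = 1 := by
  have : loc p g = PowerSeries.mk fun k => (g p) ^ k := by
    ext n; simp [loc, hg.pow hp]
  rw [this, geom]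

/-- constant one -/
def one (_ : F[X]) : ℤ := 1

/-- parity of the degree -/
def lam (h : F[X]) : ℤ := (-1) ^ h.natDegree

lemma one_cm : CMult (one : F[X] → ℤ) := ⟨rfl, fun _ _ _ _ => rfl⟩

lemma lam_cm : CMult (lam : F[X] → ℤ) := by
  refine ⟨by simp [lam], fun a b ha hb => ?_⟩
  simp only [lam]
  rw [natDegree_mul ha hb, pow_add]

lemma coeff_gs_one (N : ℕ) : (gs (one : F[X] → ℤ)).coeff N = (Fintype.card F : ℤ) ^ N := by
  simp [gs, one, card_M]

lemma coeff_gs_mul_lam (g : F[X] → ℤ) (N : ℕ) :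
    (gs (fun h => g h * lam h)).coeff N = (gs g).coeff N * (-1) ^ N := by
  simp only [gs, PowerSeries.coeff_mk, Finset.sum_mul]
  refine Finset.sum_congr rfl fun x hx => ?_
  rw [lam, ((mem_M _ _).1 hx).2]

lemma coeff_gs_lam (N : ℕ) : (gs (lam : F[X] → ℤ)).coeff N = (-(Fintype.card F : ℤ)) ^ N := by
  have := coeff_gs_mul_lam (one : F[X] → ℤ) N
  rw [coeff_gs_one, ← mul_pow] at this
  have h2 : (lam : F[X] → ℤ) = fun h => one h * lam h := by
    funext h; simp [one]
  rw [h2, this]; simp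

lemma gs_one_mul :
    gs (one : F[X] → ℤ) * (1 - PowerSeries.C (Fintype.card F : ℤ) * PowerSeries.X) = 1 := by
  refine Eq.trans ?_ (geom (Fintype.card F : ℤ))
  congr 1
  ext n; rw [coeff_gs_one, PowerSeries.coeff_mk]

lemma gs_lam_mul :
    gs (lam : F[X] → ℤ) * (1 - PowerSeries.C (-(Fintype.card F : ℤ)) * PowerSeries.X) = 1 := by
  refine Eq.trans ?_ (geom (-(Fintype.card F : ℤ)))
  congr 1
  ext n; rw [coeff_gs_lam, PowerSeries.coeff_mk]

open scoped Classical in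
/-- indicator of squares -/
def sqI (h : F[X]) : ℤ := if ∃ b : F[X], b.Monic ∧ h = b ^ 2 then 1 else 0

lemma sq_of_mul {a b c : F[X]} (ha : a.Monic) (hab : IsCoprime a b) (h : a * b = c ^ 2) :
    ∃ d : F[X], d.Monic ∧ a = d ^ 2 := by
  obtain ⟨d, hd⟩ := exists_associated_pow_of_mul_eq_pow' hab h
  have hd0 : d ≠ 0 := by
    rintro rfl
    rw [zero_pow two_ne_zero] at hd
    exact ha.ne_zero ((associated_zero_iff_eq_zero _).1 hd.symm)
  obtain ⟨e, he, hde⟩ := exists_monic_assoc hd0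
  exact ⟨e, he, eq_of_monic_of_associated ha (he.pow 2) (hd.symm.trans (hde.pow_pow))⟩

lemma sqI_mult : Mult (sqI : F[X] → ℤ) := by
  constructor
  · rw [sqI, if_pos ⟨1, monic_one, by simp⟩]
  · intro a b ha hb hab
    by_cases h : ∃ c : F[X], c.Monic ∧ a * b = c ^ 2
    · obtain ⟨c, hc, h'⟩ := h
      rw [sqI, sqI, sqI, if_pos ⟨c, hc, h'⟩, if_pos (sq_of_mul ha hab h'),
        if_pos (sq_of_mul hb hab.symm (by rw [mul_comm]; exact h'))]
      rfl
    · rw [sqI, if_neg h]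
      by_cases h1 : ∃ c : F[X], c.Monic ∧ a = c ^ 2
      · by_cases h2 : ∃ c : F[X], c.Monic ∧ b = c ^ 2
        · exfalso
          obtain ⟨c, hc, rfl⟩ := h1
          obtain ⟨d, hd, rfl⟩ := h2
          exact h ⟨c * d, hc.mul hd, by ring⟩
        · rw [sqI, sqI, if_neg h2, mul_zero]
      · rw [sqI, if_neg h1, zero_mul]

lemma sqI_pow {p : F[X]} (hp : p.Monic) (hi : Irreducible p) (k : ℕ) :
    sqI (p ^ k) = if Even k then 1 else 0 := by
  rw [sqI]
  congr 1
  apply propext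
  constructor
  · rintro ⟨b, hb, h⟩
    obtain ⟨i, _, hu⟩ := (dvd_prime_pow hi.prime k).1 (⟨b, by rw [h, sq]⟩ : b ∣ p ^ k)
    have hu' := eq_of_monic_of_associated hb (hp.pow i) hu
    rw [hu', ← pow_mul] at h
    have := congrArg natDegree h
    rw [hp.natDegree_pow, hp.natDegree_pow] at this
    have := Nat.eq_of_mul_eq_mul_right hi.natDegree_pos this
    exact ⟨i, by omega⟩
  · rintro ⟨i, rfl⟩
    exact ⟨p ^ i, hp.pow i, by ring⟩

lemma loc_sqI {p : F[X]} (hp : p.Monic) (hi : Irreducible p) :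
    loc p sqI * (1 - PowerSeries.X ^ 2) = 1 := by
  ext n
  rw [mul_sub, mul_one, map_sub, PowerSeries.coeff_mul_X_pow', PowerSeries.coeff_one]
  simp only [loc, PowerSeries.coeff_mk, sqI_pow hp hi]
  rcases n with _ | _ | n
  · simp
  · simp
  · simp [Nat.even_add_one]

lemma sqI_nonneg (h : F[X]) : 0 ≤ sqI h := by
  rw [sqI]; split_ifs <;> norm_num

lemma coeff_gs_sqI_le (N : ℕ) : (gs (sqI : F[X] → ℤ)).coeff N ≤ (Fintype.card F : ℤ) ^ (N / 2) := by
  classical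
  simp only [gs, PowerSeries.coeff_mk, sqI]
  rw [Finset.sum_ite, Finset.sum_const, Finset.sum_const_zero, add_zero, nsmul_eq_mul, mul_one]
  rw [← Nat.cast_pow, ← card_M (F := F), Nat.cast_le]
  refine (Finset.card_le_card (t := (M F (N / 2)).image (fun b => b ^ 2)) ?_).trans
    Finset.card_image_le
  intro h hh
  simp only [Finset.mem_filter, mem_M, Finset.mem_image] at hh ⊢
  obtain ⟨⟨h1, h2⟩, b, hb, rfl⟩ := hh
  rw [hb.natDegree_pow] at h2
  exact ⟨b, ⟨hb, by omega⟩, rfl⟩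

lemma one_le_coeff_gs_sqI (m : ℕ) : 1 ≤ (gs (sqI : F[X] → ℤ)).coeff (2 * m) := by
  simp only [gs, PowerSeries.coeff_mk]
  have hm : (X ^ (2 * m) : F[X]) ∈ M F (2 * m) := (mem_M _ _).2 ⟨monic_X_pow _, by simp⟩
  refine le_trans ?_ (Finset.single_le_sum (f := sqI) (fun x _ => sqI_nonneg x) hm)
  rw [sqI, if_pos ⟨X ^ m, monic_X_pow _, by ring⟩]

/-- the properties of the residue character that are used -/
structure IsChar (f : F[X]) (χ : F[X] → ℤ) : Prop where
  cm : CMult χ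
  val : ∀ a, χ a = 0 ∨ χ a = 1 ∨ χ a = -1
  zero : ∀ p : F[X], p.Monic → Irreducible p → χ p = 0 → p = f
  zero_f : χ f = 0
  sum : ∀ N, f.natDegree ≤ N → ∑ h ∈ M F N, χ h = 0

lemma sum_geom {s : ℤ} (hs : s = 0 ∨ s = 1 ∨ s = -1) (k : ℕ) :
    0 ≤ ∑ x ∈ Finset.HasAntidiagonal.antidiagonal k, s ^ x.1 ∧
      (Even k → 1 ≤ ∑ x ∈ Finset.HasAntidiagonal.antidiagonal k, s ^ x.1) := by
  rw [Finset.Nat.sum_antidiagonal_eq_sum_range_succ_mk]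
  rcases hs with rfl | rfl | rfl
  · rw [Finset.sum_range_succ']
    simp
  · simp; omega
  · simp only [neg_one_geom_sum, Nat.even_add_one]
    constructor
    · split_ifs <;> norm_num
    · intro h; simp [h]

lemma even_case {f : F[X]} {χ : F[X] → ℤ} (H : IsChar f χ)
    (hn : ∀ p : F[X], p.Monic → Irreducible p → Odd p.natDegree → χ p = 1) : False := by
  set ψ : F[X] → ℤ := fun h => χ h * lam h with hψ
  have cψ : CMult ψ := H.cm.mul lam_cm
  have vψ : ∀ a, ψ a = 0 ∨ ψ a = 1 ∨ ψ a = -1 := by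
    intro a
    rcases H.val a with h | h | h <;> rcases neg_one_pow_eq_or ℤ a.natDegree with h' | h' <;>
      simp [hψ, lam, h, h']
  have mr : Mult (conv ψ one) := conv_mult cψ.mult one_cm.mult
  have hpk : ∀ p : F[X], p.Monic → Irreducible p → ∀ k,
      conv ψ one (p ^ k) = ∑ x ∈ Finset.HasAntidiagonal.antidiagonal k, ψ p ^ x.1 := by
    intro p hp hi k
    have := congrArg (PowerSeries.coeff k) (loc_conv hp hi ψ one)
    rw [PowerSeries.coeff_mul] at this
    simpa [loc, one, cψ.pow hp.ne_zero] using this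
  have hnn : ∀ h : F[X], h.Monic → 0 ≤ conv ψ one h := by
    refine mon_induction _ (by rw [mr.1]; norm_num) ?_ ?_
    · intro p hp hi k
      rw [hpk p hp hi]; exact (sum_geom (vψ p) k).1
    · intro a b ha hb hc h1 h2
      rw [mr.2 a b ha hb hc]; exact mul_nonneg h1 h2
  have hpos : ∀ m, 1 ≤ (gs (conv ψ one)).coeff (2 * m) := by
    intro m
    simp only [gs, PowerSeries.coeff_mk]
    have hm : (X ^ (2 * m) : F[X]) ∈ M F (2 * m) := (mem_M _ _).2 ⟨monic_X_pow _, by simp⟩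
    refine le_trans ?_ (Finset.single_le_sum (f := conv ψ one)
      (fun x hx => hnn x ((mem_M _ _).1 hx).1) hm)
    rw [hpk X monic_X irreducible_X]
    exact (sum_geom (vψ _) _).2 ⟨m, by ring⟩
  have heq : gs (conv ψ one) = gs (conv χ lam) := by
    apply gs_congr
    apply mult_ext mr (conv_mult H.cm.mult lam_cm.mult)
    intro p hp hi
    rw [loc_conv hp hi, loc_conv hp hi]
    have e1 := loc_cm cψ hp.ne_zero
    have e2 := loc_cm (one_cm (F := F)) hp.ne_zero
    have e3 := loc_cm H.cm hp.ne_zero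
    have e4 := loc_cm (lam_cm (F := F)) hp.ne_zero
    rcases Nat.even_or_odd p.natDegree with hd | hd
    · have hl : lam p = 1 := by simp [lam, hd]
      have hx : ψ p = χ p := by simp [hψ, hl]
      rw [hl] at e4
      rw [hx] at e1
      simp only [one] at e2
      have u1 := left_inv_eq_right_inv e1 ((mul_comm _ _).trans e3)
      have u2 := left_inv_eq_right_inv e2 ((mul_comm _ _).trans e4)
      rw [u1, u2]
    · have hc := hn p hp hi hd
      have hx : ψ p = lam p := by simp [hψ, hc]
      rw [hc] at e3
      rw [hx] at e1
      simp only [one] at e2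
      have u1 := left_inv_eq_right_inv e1 ((mul_comm _ _).trans e4)
      have u2 := left_inv_eq_right_inv e2 ((mul_comm _ _).trans e3)
      rw [u1, u2, mul_comm]
  have hodd : ∀ N, Odd N → (gs (conv ψ one)).coeff N = 0 := by
    intro N hN
    have h2 : (gs (conv χ lam)).coeff N = - (gs (conv ψ one)).coeff N := by
      rw [gs_conv, gs_conv, PowerSeries.coeff_mul, PowerSeries.coeff_mul, ← Finset.sum_neg_distrib]
      refine Finset.sum_congr rfl ?_
      rintro ⟨i, j⟩ hij
      rw [Finset.HasAntidiagonal.mem_antidiagonal] at hij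
      simp only at hij ⊢
      rw [hψ, coeff_gs_mul_lam, coeff_gs_lam, coeff_gs_one, neg_pow]
      have : (-1 : ℤ) ^ i * (-1) ^ j = -1 := by
        rw [← pow_add, hij, hN.neg_one_pow]
      rcases neg_one_pow_eq_or ℤ j with h | h <;> rw [h] at this ⊢
      · rw [show (-1 : ℤ) ^ i = -1 by linarith]; ring
      · rw [show (-1 : ℤ) ^ i = 1 by linarith]; ring
    rw [heq] at h2
    rw [heq]
    linarith
  have hrec : gs (conv ψ one) * (1 - PowerSeries.C (Fintype.card F : ℤ) * PowerSeries.X) = gs ψ := by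
    rw [gs_conv, mul_assoc, gs_one_mul, mul_one]
  have h3 := congrArg (PowerSeries.coeff (2 * f.natDegree + 1)) hrec
  rw [mul_sub, mul_one, mul_comm (PowerSeries.C _), ← mul_assoc, map_sub,
    PowerSeries.coeff_mul_C, PowerSeries.coeff_succ_mul_X, hodd _ ⟨_, rfl⟩, hψ,
    coeff_gs_mul_lam] at h3
  have h4 : (gs χ).coeff (2 * f.natDegree + 1) = 0 := by
    simp only [gs, PowerSeries.coeff_mk]
    exact H.sum _ (by omega)
  rw [h4, zero_mul] at h3
  have h5 := hpos f.natDegree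
  have h6 : (0 : ℤ) < Fintype.card F := by exact_mod_cast Fintype.card_pos
  have h7 := mul_pos (lt_of_lt_of_le one_pos h5) h6
  rw [← hψ] at h3
  linarith

lemma odd_case {f : F[X]} {χ : F[X] → ℤ} (H : IsChar f χ) (hq : 3 ≤ Fintype.card F)
    (hf : Odd f.natDegree)
    (hn : ∀ p : F[X], p.Monic → Irreducible p → Even p.natDegree → χ p = -1) : False := by
  set ψ : F[X] → ℤ := fun h => χ h * lam h with hψ
  have cψ : CMult ψ := H.cm.mul lam_cm
  set B : F[X] → ℤ := fun h => sqI h * (χ h * χ h) with hB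
  have mB : Mult B := by
    refine ⟨by simp [hB, sqI_mult.1, H.cm.1], ?_⟩
    intro a b ha hb hc
    simp only [hB]
    rw [sqI_mult.2 a b ha hb hc, H.cm.2 a b ha.ne_zero hb.ne_zero]
    ring
  have hχ2 : ∀ a, 0 ≤ χ a * χ a ∧ χ a * χ a ≤ 1 := by
    intro a; rcases H.val a with h | h | h <;> simp [h]
  have B0 : ∀ a, 0 ≤ B a := fun a => mul_nonneg (sqI_nonneg a) (hχ2 a).1
  have BA : ∀ a, B a ≤ sqI a := fun a => mul_le_of_le_one_right (sqI_nonneg a) (hχ2 a).2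
  have heq : gs (conv (conv χ one) (conv ψ lam)) = gs (conv sqI B) := by
    apply gs_congr
    apply mult_ext (conv_mult (conv_mult H.cm.mult one_cm.mult) (conv_mult cψ.mult lam_cm.mult))
      (conv_mult sqI_mult mB)
    intro p hp hi
    rw [loc_conv hp hi, loc_conv hp hi, loc_conv hp hi, loc_conv hp hi]
    have e1 := loc_cm cψ hp.ne_zero
    have e2 := loc_cm (one_cm (F := F)) hp.ne_zero
    have e3 := loc_cm H.cm hp.ne_zero
    have e4 := loc_cm (lam_cm (F := F)) hp.ne_zero
    have e5 := loc_sqI hp hi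
    simp only [one] at e2
    by_cases h0 : χ p = 0
    · have hpf := H.zero p hp hi h0
      have hl : lam p = -1 := by rw [lam, hpf, hf.neg_one_pow]
      have hx : ψ p = 0 := by simp [hψ, h0]
      have e6 : loc p B = 1 := by
        ext k
        simp only [loc, PowerSeries.coeff_mk, hB, H.cm.pow hp.ne_zero, h0, PowerSeries.coeff_one]
        rcases k with _ | k
        · simp [sqI_mult.1]
        · simp
      rw [hx] at e1
      rw [h0] at e3
      rw [hl] at e4
      simp only [map_zero, map_one, map_neg, zero_mul, sub_zero, mul_one] at e1 e2 e3 e4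
      rw [e1, e3, e6, one_mul, one_mul, mul_one]
      refine left_inv_eq_right_inv (a := 1 - PowerSeries.X ^ 2) ?_ ((mul_comm _ _).trans e5)
      linear_combination (1 + PowerSeries.X) * loc p lam * e2 + e4
    · have e6 : loc p B = loc p sqI := by
        ext k
        have : χ p * χ p = 1 := by
          rcases H.val p with h | h | h
          · exact absurd h h0
          · simp [h]
          · simp [h]
        simp only [loc, PowerSeries.coeff_mk, hB, H.cm.pow hp.ne_zero, ← mul_pow, this]
        simp
      have key : (1 - PowerSeries.C (ψ p) * PowerSeries.X) *
          (1 - PowerSeries.C (1 : ℤ) * PowerSeries.X) *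
          (1 - PowerSeries.C (χ p) * PowerSeries.X) *
          (1 - PowerSeries.C (lam p) * PowerSeries.X) = (1 - PowerSeries.X ^ 2) ^ 2 := by
        rcases Nat.even_or_odd p.natDegree with hd | hd
        · have hl : lam p = 1 := by simp [lam, hd]
          have hc := hn p hp hi hd
          simp only [hψ, hl, hc, map_one, map_neg, mul_one]
          ring
        · have hl : lam p = -1 := by rw [lam, hd.neg_one_pow]
          rcases H.val p with h | h | h
          · exact absurd h h0
          · simp only [hψ, hl, h, map_one, map_neg, mul_one, mul_neg]
            ring
          · simp only [hψ, hl, h, map_one, map_neg, mul_one, mul_neg, neg_neg]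
            ring
      rw [e6]
      refine left_inv_eq_right_inv (a := ((1 : PowerSeries ℤ) - PowerSeries.X ^ 2) ^ 2) ?_ ?_
      · rw [← key]
        calc _ = (loc p ψ * (1 - PowerSeries.C (ψ p) * PowerSeries.X)) *
          (loc p one * (1 - PowerSeries.C (1 : ℤ) * PowerSeries.X)) *
          (loc p χ * (1 - PowerSeries.C (χ p) * PowerSeries.X)) *
          (loc p lam * (1 - PowerSeries.C (lam p) * PowerSeries.X)) := by ring
          _ = 1 := by simp only [e1, e3, e4, e2, mul_one, one]
      · calc _ = (loc p sqI * (1 - PowerSeries.X ^ 2)) ^ 2 := by ring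
          _ = 1 := by rw [e5, one_pow]
  set q : ℤ := (Fintype.card F : ℤ) with hqd
  have hq3 : (3 : ℤ) ≤ q := by rw [hqd]; exact_mod_cast hq
  set w : ℕ → ℤ := fun N => (gs (conv sqI B)).coeff N with hw
  have gB0 : ∀ N, 0 ≤ (gs B).coeff N := fun N => by
    simp only [gs, PowerSeries.coeff_mk]; exact Finset.sum_nonneg fun x _ => B0 x
  have gA0 : ∀ N, 0 ≤ (gs (sqI : F[X] → ℤ)).coeff N := fun N => by
    simp only [gs, PowerSeries.coeff_mk]; exact Finset.sum_nonneg fun x _ => sqI_nonneg x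
  have gBA : ∀ N, (gs B).coeff N ≤ q ^ (N / 2) := fun N => by
    refine le_trans ?_ (coeff_gs_sqI_le N)
    simp only [gs, PowerSeries.coeff_mk]; exact Finset.sum_le_sum fun x _ => BA x
  have hlow : ∀ m, 1 ≤ w (2 * m) := by
    intro m
    simp only [hw, gs_conv, PowerSeries.coeff_mul]
    have hm : (2 * m, 0) ∈ Finset.HasAntidiagonal.antidiagonal (2 * m) := by simp
    refine le_trans ?_ (Finset.single_le_sum
      (f := fun x : ℕ × ℕ => (gs (sqI : F[X] → ℤ)).coeff x.1 * (gs B).coeff x.2)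
      (fun x _ => mul_nonneg (gA0 _) (gB0 _)) hm)
    have : (gs B).coeff 0 = 1 := by
      simp only [gs, PowerSeries.coeff_mk, M, Finset.sum_singleton, mB.1]
    simp only [this, mul_one]
    exact one_le_coeff_gs_sqI m
  have hup : ∀ m, w (2 * m) ≤ (2 * m + 1) * q ^ m := by
    intro m
    simp only [hw, gs_conv, PowerSeries.coeff_mul]
    refine (Finset.sum_le_card_nsmul _ _ (q ^ m) ?_).trans ?_
    · rintro ⟨i, j⟩ hij
      rw [Finset.HasAntidiagonal.mem_antidiagonal] at hij
      simp only at hij ⊢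
      calc _ ≤ q ^ (i / 2) * q ^ (j / 2) :=
            mul_le_mul (coeff_gs_sqI_le i) (gBA j) (gB0 j) (by positivity)
        _ = q ^ (i / 2 + j / 2) := (pow_add _ _ _).symm
        _ ≤ q ^ m := pow_le_pow_right₀ (by linarith) (by omega)
    · simp
  have hprod : gs (conv sqI B) * (1 - PowerSeries.C (q ^ 2) * PowerSeries.X ^ 2) =
      gs χ * gs ψ := by
    rw [← heq, gs_conv, gs_conv, gs_conv]
    have e1 := gs_one_mul (F := F)
    have e2 := gs_lam_mul (F := F)
    rw [← hqd] at e1 e2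
    calc _ = gs χ * gs ψ * (gs one * (1 - PowerSeries.C q * PowerSeries.X)) *
        (gs lam * (1 - PowerSeries.C (-q) * PowerSeries.X)) := by
          rw [map_pow, map_neg]; ring
      _ = _ := by rw [e1, e2, mul_one, mul_one]
  have hχ0 : ∀ N, f.natDegree ≤ N → (gs χ).coeff N = 0 := by
    intro N hN
    simp only [gs, PowerSeries.coeff_mk]
    exact H.sum _ hN
  have hrec : ∀ N, 2 * f.natDegree ≤ N → w (N + 2) = w N * q ^ 2 := by
    intro N hN
    have h3 := congrArg (PowerSeries.coeff (N + 2)) hprod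
    rw [mul_sub, mul_one, mul_comm (PowerSeries.C _), ← mul_assoc, map_sub,
      PowerSeries.coeff_mul_C, PowerSeries.coeff_mul_X_pow, PowerSeries.coeff_mul] at h3
    rw [Finset.sum_eq_zero] at h3
    · simp only [hw]; linarith
    · rintro ⟨i, j⟩ hij
      rw [Finset.HasAntidiagonal.mem_antidiagonal] at hij
      simp only at hij ⊢
      rcases le_total f.natDegree i with h | h
      · rw [hχ0 i h, zero_mul]
      · rw [hψ, coeff_gs_mul_lam, hχ0 j (by omega), zero_mul, mul_zero]
  have hgrow : ∀ k, q ^ (2 * k) ≤ w (2 * (f.natDegree + k)) := by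
    intro k
    induction k with
    | zero => simpa using hlow f.natDegree
    | succ k ih =>
      rw [show 2 * (f.natDegree + (k + 1)) = 2 * (f.natDegree + k) + 2 by ring,
        hrec _ (by omega), show 2 * (k + 1) = 2 * k + 2 by ring, pow_add]
      exact mul_le_mul_of_nonneg_right ih (by positivity)
  have hexp : ∀ j : ℕ, (4 * j : ℤ) - 3 < q ^ j := by
    intro j
    refine lt_of_lt_of_le ?_ (pow_le_pow_left₀ (by norm_num) hq3 j)
    induction j with
    | zero => norm_num
    | succ j ih =>
      rw [pow_succ]
      have : (1 : ℤ) ≤ 3 ^ j := one_le_pow₀ (by norm_num)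
      push_cast
      rcases Nat.lt_or_ge j 2 with h | h
      · interval_cases j <;> norm_num
      · have : (2 : ℤ) ≤ j := by exact_mod_cast h
        linarith
  set n := f.natDegree
  have h1 := (hgrow (3 * n + 2)).trans (hup _)
  have h2 := hexp (2 * n + 2)
  rw [show 2 * (3 * n + 2) = (2 * n + 2) + (n + (3 * n + 2)) by ring, pow_add] at h1
  have h3 := le_of_mul_le_mul_right h1 (by positivity)
  push_cast at h2 h3
  linarith

lemma pow_val (hq : Odd (Fintype.card F)) {K : Type} [Field K] [Fintype K] [Algebra F K] (n : ℕ)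
    (hK : Fintype.card K = Fintype.card F ^ n) (g : F) (hg : ¬ IsSquare g) :
    (algebraMap F K g) ^ (Fintype.card K / 2) = (-1) ^ n := by
  have hF : ringChar F ≠ 2 := by
    intro h
    have := FiniteField.even_card_of_char_two h
    obtain ⟨m, hm⟩ := hq
    omega
  have g0 : g ≠ 0 := by rintro rfl; exact hg ⟨0, by simp⟩
  have h1 : g ^ (Fintype.card F / 2) = -1 :=
    (FiniteField.pow_dichotomy hF g0).resolve_left fun h => hg ((FiniteField.isSquare_iff hF g0).2 h)
  obtain ⟨m, hm⟩ := id hq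
  have h2 := geom_sum_mul_add (2 * m) n
  rw [← hm, ← hK] at h2
  set S := ∑ i ∈ Finset.range n, Fintype.card F ^ i with hS
  have h3 : Fintype.card K / 2 = (Fintype.card F / 2) * S := by
    have e : Fintype.card F / 2 = m := by omega
    have : S * (2 * m) = 2 * (m * S) := by ring
    rw [e]
    omega
  rw [h3, pow_mul, ← map_pow, h1, map_neg, map_one, hS, ← Finset.prod_pow_eq_pow_sum]
  rw [Finset.prod_congr rfl (g := fun _ => (-1 : K))]
  · simp
  · intro i _
    exact (hq.pow).neg_one_pow

open scoped Classical in
lemma isChar {f : F[X]} (hfm : f.Monic) (hfi : Irreducible f) {K : Type} [Field K] [Fintype K]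
    (hK : ringChar K ≠ 2) (π : F[X] →+* K) (hs : Function.Surjective π)
    (hker : ∀ a, π a = 0 ↔ f ∣ a) : IsChar f (fun a => quadraticChar K (π a)) where
  cm := ⟨by simp, fun a b _ _ => by simp only [map_mul]⟩
  val a := by
    by_cases h : π a = 0
    · left; simp [h]
    · right; exact quadraticChar_dichotomy h
  zero p hp hi h := by
    rw [quadraticChar_eq_zero_iff, hker] at h
    exact (eq_of_monic_of_associated hfm hp (hfi.associated_of_dvd hi h)).symm
  zero_f := by
    rw [quadraticChar_eq_zero_iff, hker]
  sum N hN := by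
    have htr : ∀ y : K, ∑ h ∈ M F N, quadraticChar K (π h) =
        ∑ h ∈ M F N, quadraticChar K (π h + y) := by
      intro y
      obtain ⟨a, rfl⟩ := hs y
      set r := a %ₘ f with hr
      have hra : π r = π a := by
        rw [← sub_eq_zero, ← map_sub, hker]
        have := modByMonic_add_div a f
        exact ⟨-(a /ₘ f), by rw [hr]; linear_combination this⟩
      have hd : ∀ h ∈ M F N, ∀ s : F[X], s.degree ≤ r.degree → h + s ∈ M F N := by
        intro h hh s hsr
        obtain ⟨h1, h2⟩ := (mem_M _ _).1 hh
        have hlt : s.degree < h.degree := by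
          refine lt_of_le_of_lt hsr (lt_of_lt_of_le (degree_modByMonic_lt a hfm) ?_)
          rw [degree_eq_natDegree hfm.ne_zero, degree_eq_natDegree h1.ne_zero, h2]
          exact_mod_cast hN
        rw [mem_M]
        exact ⟨h1.add_of_left hlt, by rw [natDegree_add_eq_left_of_degree_lt hlt, h2]⟩
      symm
      refine Finset.sum_nbij' (fun h => h + r) (fun h => h + -r) ?_ ?_ ?_ ?_ ?_
      · intro h hh; exact hd h hh r le_rfl
      · intro h hh; exact hd h hh (-r) (by rw [degree_neg])
      · intro h _; ring
      · intro h _; ring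
      · intro h _; simp [hra]
    have h1 : ∑ y : K, ∑ h ∈ M F N, quadraticChar K (π h) = 0 := by
      rw [Finset.sum_congr rfl fun y _ => htr y, Finset.sum_comm]
      refine Finset.sum_eq_zero fun h _ => ?_
      rw [← quadraticChar_sum_zero hK]
      exact Fintype.sum_equiv (Equiv.addLeft (π h)) _ _ fun y => rfl
    rw [Finset.sum_const, nsmul_eq_mul] at h1
    refine (mul_eq_zero.1 h1).resolve_left ?_
    rw [Finset.card_univ]
    exact_mod_cast Fintype.card_ne_zero

lemma main (hq : Odd (Fintype.card F)) {f : F[X]} (hfm : f.Monic) (hfi : Irreducible f) :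
    ∃ d : Polynomial F, d.Monic ∧ Irreducible d ∧ (Even f.natDegree ↔ Odd d.natDegree) ∧
      ∀ g : F, ¬ IsSquare g →
        ¬ IsSquare (AdjoinRoot.mk f (C g * d)) := by
  classical
  haveI : Fact (Irreducible f) := ⟨hfi⟩
  haveI : Module.Finite F (AdjoinRoot f) := (AdjoinRoot.powerBasis hfi.ne_zero).finite
  haveI : Finite (AdjoinRoot f) := Module.finite_of_finite F
  letI : Fintype (AdjoinRoot f) := Fintype.ofFinite _
  have hcard : Fintype.card (AdjoinRoot f) = Fintype.card F ^ f.natDegree := by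
    rw [Module.card_eq_pow_finrank (K := F), (AdjoinRoot.powerBasis hfi.ne_zero).finrank,
      AdjoinRoot.powerBasis_dim]
  have hK : ringChar (AdjoinRoot f) ≠ 2 := by
    intro h
    have h1 := FiniteField.even_card_of_char_two h
    obtain ⟨m, hm⟩ := (hcard ▸ hq.pow : Odd (Fintype.card (AdjoinRoot f)))
    omega
  have H := isChar hfm hfi hK (AdjoinRoot.mk f) AdjoinRoot.mk_surjective
    (fun a => AdjoinRoot.mk_eq_zero)
  set χ : F[X] → ℤ := fun a => quadraticChar (AdjoinRoot f) (AdjoinRoot.mk f a) with hχ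
  have hq3 : 3 ≤ Fintype.card F := by
    have := Fintype.one_lt_card (α := F)
    obtain ⟨m, hm⟩ := hq
    omega
  have hg : ∀ g : F, ¬ IsSquare g → AdjoinRoot.mk f (C g) ≠ 0 ∧
      (AdjoinRoot.mk f (C g)) ^ (Fintype.card (AdjoinRoot f) / 2) = (-1) ^ f.natDegree := by
    intro g hg
    have e : AdjoinRoot.mk f (C g) = algebraMap F (AdjoinRoot f) g := rfl
    rw [e]
    refine ⟨?_, pow_val hq _ hcard g hg⟩
    intro h0
    rw [map_eq_zero] at h0
    exact hg ⟨0, by simp [h0]⟩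
  rcases Nat.even_or_odd f.natDegree with hn | hn
  · obtain ⟨p, hp, hi, hd, hc⟩ : ∃ p : F[X], p.Monic ∧ Irreducible p ∧ Odd p.natDegree ∧ χ p ≠ 1 := by
      by_contra! hcon
      exact even_case H fun p hp hi hd => hcon p hp hi hd
    have hc' : χ p = -1 := by
      rcases H.val p with h | h | h
      · have := H.zero p hp hi h
        rw [this] at hd
        exact absurd hn (Nat.not_even_iff_odd.2 hd)
      · exact absurd h hc
      · exact h
    refine ⟨p, hp, hi, by simp [hn, hd], fun g hgs => ?_⟩
    obtain ⟨g0, g1⟩ := hg g hgs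
    rw [hn.neg_one_pow] at g1
    have g2 := (quadraticChar_one_iff_isSquare g0).2 ((FiniteField.isSquare_iff hK g0).2 g1)
    rw [← quadraticChar_neg_one_iff_not_isSquare, map_mul, map_mul, g2, one_mul]
    exact hc'
  · obtain ⟨p, hp, hi, hd, hc⟩ : ∃ p : F[X], p.Monic ∧ Irreducible p ∧ Even p.natDegree ∧ χ p ≠ -1 := by
      by_contra! hcon
      exact odd_case H hq3 hn fun p hp hi hd => hcon p hp hi hd
    have hc' : χ p = 1 := by
      rcases H.val p with h | h | h
      · have := H.zero p hp hi h
        rw [this] at hd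
        exact absurd hd (Nat.not_even_iff_odd.2 hn)
      · exact h
      · exact absurd h hc
    refine ⟨p, hp, hi, ?_, fun g hgs => ?_⟩
    · rw [← Nat.not_even_iff_odd, ← Nat.not_odd_iff_even]; simp [hn, hd]
    obtain ⟨g0, g1⟩ := hg g hgs
    rw [hn.neg_one_pow] at g1
    have g2 : quadraticChar (AdjoinRoot f) (AdjoinRoot.mk f (C g)) = -1 := by
      rw [quadraticChar_neg_one_iff_not_isSquare, FiniteField.isSquare_iff hK g0, g1]
      exact Ring.neg_one_ne_one_of_char_ne_two hK
    rw [← quadraticChar_neg_one_iff_not_isSquare, map_mul, map_mul, g2]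
    change -1 * χ p = -1
    rw [hc']; rfl

end FFDir
end

open Quaternion HahnSeries IsDedekindDomain Polynomial Multiplicative
noncomputable section

/-- For every monic irreducible `f` there is a monic irreducible `d` of degree of opposite
parity such that for every nonsquare `g ∈ F_q`, the residue of `g·d` mod `f` is a nonsquare. -/
theorem stmt5 (F : Type) [Field F] [Fintype F] (hq : Odd (Fintype.card F))
    (f : Polynomial F) (hfm : f.Monic) (hfi : Irreducible f) :
    ∃ d : Polynomial F, d.Monic ∧ Irreducible d ∧ (Even f.natDegree ↔ Odd d.natDegree) ∧
      ∀ g : F, ¬ IsSquare g →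
        ¬ IsSquare (Ideal.Quotient.mk (Ideal.span {f}) (C g * d)) := by
  exact FFDir.main hq hfm hfi
end
end

section
/- Let q be an odd prime power and f(t) ∈ F_q[t] monic irreducible. For every sufficiently large N, and every residue class c(t) mod f(t) with gcd(c,f) = 1, there exists a monic irreducible polynomial d(t) ∈ F_q[t] of degree N with d(t) ≡ c(t) mod f(t). -/
namespace DirPoly
open Polynomial

section Monic
variable {F : Type} [Field F] [Fintype F]

lemma finite_monic (n : ℕ) : {p : F[X] | p.Monic ∧ p.natDegree = n}.Finite := by
  have e := (monicEquivDegreeLT (R := F) n).trans (degreeLTEquiv F n).toEquiv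
  have : Finite {p : F[X] | p.Monic ∧ p.natDegree = n} := Finite.of_equiv _ e.symm
  exact Set.toFinite _

/-- monic polynomials of degree `n` -/
noncomputable def MP (F : Type) [Field F] [Fintype F] (n : ℕ) : Finset F[X] :=
  (finite_monic (F := F) n).toFinset

lemma mem_MP {n : ℕ} {p : F[X]} : p ∈ MP F n ↔ p.Monic ∧ p.natDegree = n := by
  simp [MP]

lemma card_MP (n : ℕ) : (MP F n).card = Fintype.card F ^ n := by
  have e := (monicEquivDegreeLT (R := F) n).trans (degreeLTEquiv F n).toEquiv
  have h : Nat.card {p : F[X] | p.Monic ∧ p.natDegree = n} = Fintype.card F ^ n := by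
    have := Nat.card_congr e
    simp only [Nat.card_eq_fintype_card, Fintype.card_fun, Fintype.card_fin] at this
    exact this
  rw [← h, MP, ← Set.ncard_eq_toFinset_card _ _, Set.ncard_def]
  rfl

open Classical in
/-- monic irreducible polynomials of degree `n` -/
noncomputable def IP (F : Type) [Field F] [Fintype F] (n : ℕ) : Finset F[X] :=
  (MP F n).filter Irreducible

lemma mem_IP {n : ℕ} {p : F[X]} : p ∈ IP F n ↔ p.Monic ∧ p.natDegree = n ∧ Irreducible p := by
  simp [IP, mem_MP, and_assoc]

lemma MP_zero : MP F 0 = {1} := by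
  ext p
  simp only [mem_MP, Finset.mem_singleton]
  constructor
  · rintro ⟨h1, h2⟩; exact h1.natDegree_eq_zero.mp h2
  · rintro rfl; simp

open Classical in
lemma sum_dvd {n j : ℕ} {g : F[X]} (hg : g.Monic) (hj : g.natDegree = j) (h : F[X] → ℂ) :
    ∑ d ∈ MP F n, (if g ∣ d then h d else 0) =
      if j ≤ n then ∑ e ∈ MP F (n - j), h (g * e) else 0 := by
  split_ifs with hjn
  · rw [← Finset.sum_filter]
    symm
    refine Finset.sum_bij (fun e _ => g * e) ?_ ?_ ?_ ?_
    · intro e he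
      rw [mem_MP] at he
      simp only [Finset.mem_filter, mem_MP, dvd_mul_right, and_true]
      refine ⟨hg.mul he.1, ?_⟩
      rw [hg.natDegree_mul he.1]; omega
    · intro a _ b _ hab
      exact mul_left_cancel₀ hg.ne_zero hab
    · intro d hd
      simp only [Finset.mem_filter, mem_MP] at hd
      obtain ⟨⟨hd1, hd2⟩, e, rfl⟩ := hd
      have he : e.Monic := hg.of_mul_monic_left hd1
      refine ⟨e, ?_, rfl⟩
      rw [mem_MP]
      refine ⟨he, ?_⟩
      rw [hg.natDegree_mul he] at hd2; omega
    · intros; rfl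
  · apply Finset.sum_eq_zero
    intro d hd
    rw [mem_MP] at hd
    rw [if_neg]
    intro hdv
    have := natDegree_le_of_dvd hdv hd.1.ne_zero
    omega

open Classical UniqueFactorizationMonoid in
lemma natDegree_eq_sum {n : ℕ} {d : F[X]} (hd : d ∈ MP F n) :
    n = ∑ j ∈ Finset.Icc 1 n, ∑ P ∈ IP F j, ∑ k ∈ Finset.Icc 1 n,
      if P ^ k ∣ d then j else 0 := by
  obtain ⟨hm, hn⟩ := mem_MP.mp hd
  have hd0 := hm.ne_zero
  set s := normalizedFactors d with hs
  have hsm : ∀ P ∈ s, P.Monic := fun P hP => by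
    have := normalize_normalized_factor P hP
    rw [← this]; exact monic_normalize (irreducible_of_normalized_factor P hP).ne_zero
  have hprod : s.prod = d := by
    rw [hs, prod_normalizedFactors_eq hd0]; exact hm.normalize_eq_self
  have h1 : n = ∑ P ∈ s.toFinset, s.count P * P.natDegree := by
    rw [← hn, ← hprod, natDegree_multiset_prod_of_monic _ hsm, Finset.sum_multiset_map_count]
    simp
  have hcount : ∀ P ∈ s, ∑ k ∈ Finset.Icc 1 n, (if P ^ k ∣ d then P.natDegree else 0) =
      s.count P * P.natDegree := by
    intro P hP
    have hi := irreducible_of_normalized_factor P hP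
    have hle : s.count P ≤ n := by
      have : P ^ s.count P ∣ d := by
        rw [pow_dvd_iff_le_emultiplicity, emultiplicity_eq_count_normalizedFactors hi hd0,
          (hsm P hP).normalize_eq_self]
      have := natDegree_le_of_dvd this hd0
      rw [(hsm P hP).natDegree_pow, hn] at this
      have := hi.natDegree_pos
      nlinarith
    have hiff : ∀ k, P ^ k ∣ d ↔ k ≤ s.count P := by
      intro k
      rw [pow_dvd_iff_le_emultiplicity, emultiplicity_eq_count_normalizedFactors hi hd0,
          (hsm P hP).normalize_eq_self]
      exact Nat.cast_le
    simp only [hiff]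
    rw [← Finset.sum_filter, Finset.sum_const, smul_eq_mul]
    congr 1
    have : Finset.filter (fun k => k ≤ s.count P) (Finset.Icc 1 n) = Finset.Icc 1 (s.count P) := by
      ext k; simp; omega
    rw [this]; simp
  have hmem : ∀ P, P ∈ s ↔ P.Monic ∧ Irreducible P ∧ P ∣ d := by
    intro P
    constructor
    · intro hP
      exact ⟨hsm P hP, irreducible_of_normalized_factor P hP, dvd_of_mem_normalizedFactors hP⟩
    · rintro ⟨h1, h2, h3⟩
      exact (mem_normalizedFactors_iff' hd0).mpr ⟨h2, h1.normalize_eq_self, h3⟩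
  have h2 : ∑ j ∈ Finset.Icc 1 n, ∑ P ∈ IP F j, (∑ k ∈ Finset.Icc 1 n,
      if P ^ k ∣ d then j else 0) = ∑ P ∈ s.toFinset, s.count P * P.natDegree := by
    have : ∀ j ∈ Finset.Icc 1 n, ∑ P ∈ IP F j, (∑ k ∈ Finset.Icc 1 n,
      if P ^ k ∣ d then j else 0) = 
        ∑ P ∈ s.toFinset with P.natDegree = j, s.count P * P.natDegree := by
      intro j hj
      symm
      have hsub : (s.toFinset.filter (fun P => P.natDegree = j)) ⊆ IP F j := by
        intro P hP
        simp only [Finset.mem_filter, Multiset.mem_toFinset, hmem] at hP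
        exact mem_IP.mpr ⟨hP.1.1, hP.2, hP.1.2.1⟩
      rw [← Finset.sum_subset hsub]
      · refine Finset.sum_congr rfl fun P hP => ?_
        simp only [Finset.mem_filter, Multiset.mem_toFinset] at hP
        rw [← hcount P hP.1, hP.2]
      · intro P hP hP'
        obtain ⟨a1, a2, a3⟩ := mem_IP.mp hP
        apply Finset.sum_eq_zero
        intro k hk
        rw [if_neg]
        intro hdv
        apply hP'
        simp only [Finset.mem_filter, Multiset.mem_toFinset, hmem]
        refine ⟨⟨a1, a3, (dvd_pow_self P ?_).trans hdv⟩, a2⟩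
        simp at hk; omega
    rw [Finset.sum_congr rfl this]
    refine Finset.sum_fiberwise_of_maps_to ?_ _
    intro P hP
    simp only [Multiset.mem_toFinset, hmem] at hP
    have h3 := hP.2.1.natDegree_pos
    have h4 := natDegree_le_of_dvd hP.2.2 hd0
    simp; omega
  rw [h2]; exact h1

/-- coefficient sums -/
noncomputable def aC (ψ : F[X] →* ℂ) (n : ℕ) : ℂ := ∑ d ∈ MP F n, ψ d

/-- prime power sums -/
noncomputable def SC (ψ : F[X] →* ℂ) (N : ℕ) : ℂ :=
  ∑ x ∈ N.divisorsAntidiagonal, ∑ P ∈ IP F x.1, (x.1 : ℂ) * ψ P ^ x.2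

lemma aC_zero (ψ : F[X] →* ℂ) : aC ψ 0 = 1 := by simp [aC, MP_zero]
lemma SC_zero (ψ : F[X] →* ℂ) : SC ψ 0 = 0 := by simp [SC]

lemma sum_reindex (n : ℕ) (g : ℕ → ℕ → ℂ) :
    ∑ j ∈ Finset.Icc 1 n, ∑ k ∈ Finset.Icc 1 n, (if j * k ≤ n then g j k else 0) =
    ∑ N ∈ Finset.range (n+1), ∑ x ∈ N.divisorsAntidiagonal, g x.1 x.2 := by
  rw [← Finset.sum_product', ← Finset.sum_filter, Finset.sum_sigma']
  refine Finset.sum_bij' (fun x _ => ⟨x.1 * x.2, x⟩) (fun y _ => y.2) ?_ ?_ ?_ ?_ ?_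
  · rintro ⟨j, k⟩ h
    simp at h ⊢
    refine ⟨by omega, by omega, by omega⟩
  · rintro ⟨N, j, k⟩ h
    simp at h ⊢
    obtain ⟨h1, rfl, h2⟩ := h
    have hj : 0 < j := by by_contra hh; simp at hh; simp [hh] at h2
    have hk : 0 < k := by by_contra hh; simp at hh; simp [hh] at h2
    refine ⟨⟨⟨hj, ?_⟩, hk, ?_⟩, by omega⟩ <;> nlinarith
  · rintro ⟨j, k⟩ h; rfl
  · rintro ⟨N, j, k⟩ h
    simp at h ⊢
    exact h.2.1
  · rintro ⟨j, k⟩ h; rfl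

open Classical in
lemma recur (ψ : F[X] →* ℂ) (n : ℕ) :
    (n : ℂ) * aC ψ n = ∑ N ∈ Finset.range (n+1), SC ψ N * aC ψ (n - N) := by
  have h1 : (n : ℂ) * aC ψ n = ∑ d ∈ MP F n, ∑ j ∈ Finset.Icc 1 n, ∑ P ∈ IP F j,
      ∑ k ∈ Finset.Icc 1 n, if P ^ k ∣ d then (j : ℂ) * ψ d else 0 := by
    rw [aC, Finset.mul_sum]
    refine Finset.sum_congr rfl fun d hd => ?_
    have := natDegree_eq_sum hd
    have h2 := congrArg (fun m : ℕ => (m : ℂ) * ψ d) this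
    rw [h2]
    push_cast
    simp only [Finset.sum_mul, ite_mul, zero_mul]
  have h2 : ∀ j ∈ Finset.Icc 1 n, ∀ P ∈ IP F j, ∀ k ∈ Finset.Icc 1 n,
      ∑ d ∈ MP F n, (if P ^ k ∣ d then (j : ℂ) * ψ d else 0) =
      if j * k ≤ n then (j : ℂ) * ψ P ^ k * aC ψ (n - j * k) else 0 := by
    intro j hj P hP k hk
    obtain ⟨a1, a2, a3⟩ := mem_IP.mp hP
    rw [sum_dvd (a1.pow k) (j := j * k) (by rw [a1.natDegree_pow, a2, mul_comm])]
    simp only [map_mul, map_pow, aC, Finset.mul_sum, mul_assoc]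
  have h3 : (n : ℂ) * aC ψ n = ∑ j ∈ Finset.Icc 1 n, ∑ k ∈ Finset.Icc 1 n, 
      if j * k ≤ n then (∑ P ∈ IP F j, (j : ℂ) * ψ P ^ k * aC ψ (n - j * k)) else 0 := by
    rw [h1, Finset.sum_comm]
    refine Finset.sum_congr rfl fun j hj => ?_
    rw [Finset.sum_comm]
    calc _ = ∑ P ∈ IP F j, ∑ k ∈ Finset.Icc 1 n, 
        if j * k ≤ n then (j : ℂ) * ψ P ^ k * aC ψ (n - j * k) else 0 := by
          refine Finset.sum_congr rfl fun P hP => ?_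
          rw [Finset.sum_comm]
          exact Finset.sum_congr rfl fun k hk => h2 j hj P hP k hk
      _ = _ := by
          rw [Finset.sum_comm]
          refine Finset.sum_congr rfl fun k hk => ?_
          split_ifs
          · rfl
          · simp
  rw [h3, sum_reindex n (fun j k => ∑ P ∈ IP F j, (j : ℂ) * ψ P ^ k * aC ψ (n - j * k))]
  refine Finset.sum_congr rfl fun N hN => ?_
  rw [SC, Finset.sum_mul]
  refine Finset.sum_congr rfl fun x hx => ?_
  rw [Finset.sum_mul, (Nat.mem_divisorsAntidiagonal.mp hx).1]

end Monic
end DirPoly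

namespace DirPoly
section Series
open PowerSeries

/-- Euler operator -/
noncomputable def eul (A : PowerSeries ℂ) : PowerSeries ℂ := X * d⁄dX ℂ A

lemma coeff_eul (A : PowerSeries ℂ) (n : ℕ) : coeff n (eul A) = n * coeff n A := by
  cases n with
  | zero => simp [eul]
  | succ n => rw [eul, coeff_succ_X_mul, coeff_derivative]; push_cast; ring

lemma eul_mul (A B : PowerSeries ℂ) : eul (A * B) = eul A * B + A * eul B := by
  simp only [eul, Derivation.leibniz, smul_eq_mul]; ring

/-- geometric series without constant term -/
noncomputable def geo (a : ℂ) : PowerSeries ℂ := mk fun n => if n = 0 then 0 else a ^ n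

lemma geo_mul (a : ℂ) : (1 - C a * X) * geo a = C a * X := by
  ext n
  rw [sub_mul, one_mul, mul_assoc, map_sub, coeff_C_mul, coeff_C_mul]
  rcases n with _ | _ | n
  · simp [geo]
  · rw [coeff_succ_X_mul]; simp [geo]
  · rw [coeff_succ_X_mul, coeff_X]; simp [geo, pow_succ]; ring

lemma eul_lin (a : ℂ) : eul (1 - C a * X) = - (C a * X) := by
  simp [eul]; ring

/-- product polynomial -/
noncomputable def prodS (s : Multiset ℂ) : PowerSeries ℂ := (s.map fun a => 1 - C a * X).prod

lemma eul_prodS (s : Multiset ℂ) : eul (prodS s) = - (prodS s * (s.map geo).sum) := by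
  induction s using Multiset.induction_on with
  | empty => simp [prodS, eul]
  | cons a s ih =>
    have h : prodS (a ::ₘ s) = (1 - C a * X) * prodS s := by simp [prodS]
    rw [h, eul_mul, ih, eul_lin, Multiset.map_cons, Multiset.sum_cons]
    linear_combination (prodS s) * geo_mul a

lemma coeff_sum_geo (s : Multiset ℂ) (n : ℕ) (hn : n ≠ 0) :
    coeff n (s.map geo).sum = (s.map fun a => a ^ n).sum := by
  induction s using Multiset.induction_on with
  | empty => simp
  | cons a s ih => simp [ih, geo, hn]

lemma prodS_coeff_zero (s : Multiset ℂ) : coeff 0 (prodS s) = 1 := by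
  induction s using Multiset.induction_on with
  | empty => simp [prodS]
  | cons a s ih =>
    have h : prodS (a ::ₘ s) = (1 - C a * X) * prodS s := by simp [prodS]
    rw [h]
    simp at ih
    simp [ih]

lemma prodS_ne_zero (s : Multiset ℂ) : prodS s ≠ 0 := by
  intro h
  have := prodS_coeff_zero s
  simp [h] at this

lemma prodS_coeff_large (s : Multiset ℂ) : ∀ n, s.card < n → coeff n (prodS s) = 0 := by
  induction s using Multiset.induction_on with
  | empty =>
    intro n hn
    simp at hn
    simp [prodS, coeff_one]; omega
  | cons a s ih =>
    intro n hn
    have h : prodS (a ::ₘ s) = (1 - C a * X) * prodS s := by simp [prodS]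
    rw [Multiset.card_cons] at hn
    obtain ⟨n, rfl⟩ : ∃ k, n = k + 1 := ⟨n - 1, by omega⟩
    rw [h, sub_mul, one_mul, mul_assoc, map_sub, coeff_C_mul, coeff_succ_X_mul, ih _ (by omega),
      ih _ (by omega)]
    simp

/-- factor a polynomial with constant term one -/
lemma exists_factor (p : Polynomial ℂ) (hp : p.coeff 0 = 1) :
    ∃ s : Multiset ℂ, (p : PowerSeries ℂ) = prodS s := by
  have hp0 : p ≠ 0 := by rintro rfl; simp at hp
  have hsp := (IsAlgClosed.splits p).eq_prod_roots
  have hr : ∀ r ∈ p.roots, r ≠ 0 := by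
    rintro r hr rfl
    have := (Polynomial.mem_roots hp0).mp hr
    rw [Polynomial.IsRoot, ← Polynomial.coeff_zero_eq_eval_zero, hp] at this
    exact one_ne_zero this
  have key : ∀ t : Multiset ℂ, (∀ r ∈ t, r ≠ 0) → ∃ k : ℂ,
      (((t.map fun a => Polynomial.X - Polynomial.C a).prod : Polynomial ℂ) : PowerSeries ℂ) =
        C k * prodS (t.map fun r => r⁻¹) := by
    intro t
    induction t using Multiset.induction_on with
    | empty => intro _; exact ⟨1, by simp [prodS]⟩
    | cons a t ih =>
      intro h
      obtain ⟨k, hk⟩ := ih fun r hr => h r (Multiset.mem_cons_of_mem hr)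
      have ha : a ≠ 0 := h a (Multiset.mem_cons_self a t)
      refine ⟨-a * k, ?_⟩
      have h1 : (X - C a : PowerSeries ℂ) = C (-a) * (1 - C a⁻¹ * X) := by
        rw [mul_sub, ← mul_assoc, ← map_mul]
        simp [ha]; ring
      rw [Multiset.map_cons, Multiset.prod_cons, Polynomial.coe_mul, hk, Polynomial.coe_sub,
        Polynomial.coe_X, Polynomial.coe_C, h1]
      simp only [prodS, Multiset.map_cons, Multiset.prod_cons, map_mul]
      ring
  obtain ⟨k, hk⟩ := key p.roots hr
  refine ⟨p.roots.map fun r => r⁻¹, ?_⟩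
  have h2 : (p : PowerSeries ℂ) = C (p.leadingCoeff * k) * prodS (p.roots.map fun r => r⁻¹) := by
    conv_lhs => rw [hsp]
    rw [Polynomial.coe_mul, hk, Polynomial.coe_C, map_mul, mul_assoc]
  have h3 : p.leadingCoeff * k = 1 := by
    have := congrArg (coeff 0) h2
    rw [coeff_C_mul, prodS_coeff_zero, Polynomial.coeff_coe, hp] at this
    simpa using this.symm
  rw [h2, h3]; simp

/-- a finitely supported log-derivative has power sums -/
lemma exists_powersum (a S : ℕ → ℂ) (m : ℕ) (h0 : a 0 = 1) (ha : ∀ n ≥ m, a n = 0)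
    (hrec : ∀ n : ℕ, (n : ℂ) * a n = ∑ N ∈ Finset.range (n+1), S N * a (n - N)) :
    ∃ s : Multiset ℂ, ∀ n ≠ 0, S n = - (s.map fun α => α ^ n).sum := by
  have hm : m ≠ 0 := by
    rintro rfl
    have := ha 0 (le_refl _)
    simp [h0] at this
  set p : Polynomial ℂ := ∑ i ∈ Finset.range m, Polynomial.monomial i (a i) with hp
  have hc : ∀ n, p.coeff n = a n := by
    intro n
    simp only [hp, Polynomial.finsetSum_coeff, Polynomial.coeff_monomial]
    rw [Finset.sum_ite_eq']
    split_ifs with h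
    · rfl
    · rw [ha n (by simpa using h)]
  obtain ⟨s, hs⟩ := exists_factor p (by rw [hc, h0])
  refine ⟨s, fun n hn => ?_⟩
  have h1 : eul (p : PowerSeries ℂ) = p * mk S := by
    ext n
    rw [coeff_eul, mul_comm (p : PowerSeries ℂ), coeff_mul, Polynomial.coeff_coe, hc, hrec,
      Finset.Nat.sum_antidiagonal_eq_sum_range_succ_mk]
    refine Finset.sum_congr rfl fun k _ => ?_
    simp [hc]
  rw [hs, eul_prodS, ← mul_neg] at h1
  have h2 := mul_left_cancel₀ (prodS_ne_zero s) h1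
  have h3 := congrArg (coeff n) h2
  rw [map_neg, coeff_sum_geo s n hn, coeff_mk] at h3
  exact h3.symm

open ComplexOrder in
/-- nonnegative negated power sums vanish eventually -/
lemma powersum_nonneg (s : Multiset ℂ) (h : ∀ n ≠ 0, 0 ≤ - (s.map fun α => α ^ n).sum) :
    ∀ n, s.card < n → (s.map fun α => α ^ n).sum = 0 := by
  have hrec : ∀ n : ℕ, (n : ℂ) * coeff n (prodS s) =
      ∑ k ∈ Finset.range (n+1), (if k = 0 then 0 else - (s.map fun α => α ^ k).sum) *
        coeff (n - k) (prodS s) := by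
    intro n
    rw [← coeff_eul, eul_prodS, ← mul_neg, mul_comm, coeff_mul,
      Finset.Nat.sum_antidiagonal_eq_sum_range_succ_mk]
    refine Finset.sum_congr rfl fun k _ => ?_
    congr 1
    split_ifs with hk
    · subst hk
      have : ∀ t : Multiset ℂ, coeff 0 (t.map geo).sum = 0 := by
        intro t
        induction t using Multiset.induction_on with
        | empty => simp
        | cons a t ih => 
          rw [Multiset.map_cons, Multiset.sum_cons, map_add, ih]; simp [geo]
      rw [map_neg, this]; simp
    · rw [map_neg, coeff_sum_geo s k hk]
  have hT : ∀ k, (0 : ℂ) ≤ (if k = 0 then 0 else - (s.map fun α => α ^ k).sum) := by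
    intro k
    split_ifs with hk
    · exact le_refl _
    · exact h k hk
  have hb : ∀ n, 0 ≤ coeff n (prodS s) := by
    intro n
    induction n using Nat.strong_induction_on with
    | _ n ih =>
      rcases Nat.eq_zero_or_pos n with rfl | hn
      · rw [prodS_coeff_zero]; exact zero_le_one
      · have h1 : 0 ≤ (n : ℂ) * coeff n (prodS s) := by
          rw [hrec]
          refine Finset.sum_nonneg fun k hk => ?_
          by_cases hk0 : k = 0
          · simp [hk0]
          · exact mul_nonneg (hT k) (ih _ (by omega))
        have h2 : coeff n (prodS s) = ((1 / n : ℝ) : ℂ) * ((n : ℂ) * coeff n (prodS s)) := by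
          have : (n : ℂ) ≠ 0 := by exact_mod_cast hn.ne'
          push_cast; field_simp
        rw [h2]
        refine mul_nonneg ?_ h1
        rw [Complex.zero_le_real]; positivity
  intro n hn
  have hn0 : n ≠ 0 := by omega
  have h1 := hrec n
  rw [prodS_coeff_large s n hn, mul_zero] at h1
  have h2 := (Finset.sum_eq_zero_iff_of_nonneg (fun k _ => mul_nonneg (hT k) (hb (n - k)))).mp
    h1.symm n (by simp)
  rw [if_neg hn0, Nat.sub_self, prodS_coeff_zero, mul_one] at h2
  exact neg_eq_zero.mp h2

end Series

section Means
open Filter Topology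

/-- Cesaro mean, indices from one -/
def HasMean (b : ℕ → ℂ) (l : ℂ) : Prop :=
  Tendsto (fun M : ℕ => (M : ℂ)⁻¹ * ∑ n ∈ Finset.range M, b (n + 1)) atTop (𝓝 l)

lemma HasMean.add {b c : ℕ → ℂ} {l m : ℂ} (hb : HasMean b l) (hc : HasMean c m) :
    HasMean (fun n => b n + c n) (l + m) := by
  refine (Tendsto.add hb hc).congr fun M => ?_
  rw [Finset.sum_add_distrib]; ring

lemma HasMean.const_mul {b : ℕ → ℂ} {l : ℂ} (k : ℂ) (hb : HasMean b l) :
    HasMean (fun n => k * b n) (k * l) := by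
  refine (Tendsto.const_mul k hb).congr fun M => ?_
  rw [← Finset.mul_sum]; ring

lemma HasMean.congr {b c : ℕ → ℂ} {l : ℂ} (hb : HasMean b l) (h : ∀ n ≠ 0, b n = c n) :
    HasMean c l := by
  refine Tendsto.congr (fun M => ?_) hb
  congr 1
  exact Finset.sum_congr rfl fun n _ => h _ (by omega)

lemma HasMean.of_tendsto {b : ℕ → ℂ} {l : ℂ} (hb : Tendsto b atTop (𝓝 l)) : HasMean b l := by
  have := ((tendsto_add_atTop_iff_nat 1).mpr hb).cesaro_smul
  refine this.congr fun M => ?_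
  simp

lemma HasMean.re_nonneg {b : ℕ → ℂ} {l : ℂ} (hb : HasMean b l) (h : ∀ n ≠ 0, 0 ≤ (b n).re) :
    0 ≤ l.re := by
  have h1 := (Complex.continuous_re.tendsto l).comp hb
  refine ge_of_tendsto' h1 fun M => ?_
  simp only [Function.comp]
  have : (M : ℂ)⁻¹ = ((M : ℝ)⁻¹ : ℝ) := by push_cast; rfl
  rw [this, Complex.re_ofReal_mul, Complex.re_sum]
  exact mul_nonneg (by positivity) (Finset.sum_nonneg fun n _ => h _ (by omega))

lemma hasMean_one : HasMean (fun _ => 1) 1 := HasMean.of_tendsto tendsto_const_nhds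

open Classical in
lemma hasMean_pow (z : ℂ) (hz : ‖z‖ ≤ 1) : HasMean (fun n => z ^ n) (if z = 1 then 1 else 0) := by
  split_ifs with h
  · simp only [h, one_pow]; exact hasMean_one
  · rw [HasMean, tendsto_zero_iff_norm_tendsto_zero]
    have hlim : Tendsto (fun M : ℕ => (M : ℝ)⁻¹ * (2 / ‖z - 1‖)) atTop (𝓝 0) := by
      have := (tendsto_inv_atTop_nhds_zero_nat (𝕜 := ℝ)).mul_const (2 / ‖z - 1‖)
      simpa using this
    refine squeeze_zero (fun _ => norm_nonneg _) (fun M => ?_) hlim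
    rw [norm_mul, norm_inv, Complex.norm_natCast]
    refine mul_le_mul_of_nonneg_left ?_ (by positivity)
    have h1 : ∑ n ∈ Finset.range M, z ^ (n + 1) = z * ((z ^ M - 1) / (z - 1)) := by
      rw [← geom_sum_eq h, Finset.mul_sum]
      exact Finset.sum_congr rfl fun n _ => by ring
    rw [h1, norm_mul, norm_div]
    have h2 : ‖z ^ M - 1‖ ≤ 2 := by
      refine (norm_sub_le _ _).trans ?_
      rw [norm_pow, norm_one]
      have := pow_le_one₀ (n := M) (norm_nonneg z) hz
      linarith
    calc ‖z‖ * (‖z ^ M - 1‖ / ‖z - 1‖) ≤ 1 * (2 / ‖z - 1‖) := by gcongr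
      _ = _ := one_mul _

open Classical in
lemma hasMean_multiset (s : Multiset ℂ) (hs : ∀ z ∈ s, ‖z‖ ≤ 1) :
    HasMean (fun n => (s.map fun z => z ^ n).sum) (s.count 1) := by
  induction s using Multiset.induction_on with
  | empty => simpa using HasMean.of_tendsto (tendsto_const_nhds (x := (0:ℂ)))
  | cons a s ih =>
    have h1 := (hasMean_pow a (hs a (Multiset.mem_cons_self a s))).add
      (ih fun z hz => hs z (Multiset.mem_cons_of_mem hz))
    simp only [Multiset.map_cons, Multiset.sum_cons]
    convert h1 using 1
    rw [Multiset.count_cons]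
    push_cast
    rw [add_comm]
    congr 1
    simp [eq_comm]

/-- bounded power sums bound the terms -/
lemma norm_le_of_powersum (s : Multiset ℂ) (q : ℝ) (hq : 0 < q)
    (h : ∀ n ≠ 0, ‖(s.map fun z => z ^ n).sum‖ ≤ q ^ n) : ∀ z ∈ s, ‖z‖ ≤ q := by
  classical
  by_contra! hcon
  obtain ⟨z0, hz0, hz0q⟩ := hcon
  obtain ⟨a, ha, hmax⟩ := s.toFinset.exists_max_image (fun z => ‖z‖) ⟨z0, by simpa using hz0⟩
  simp only [Multiset.mem_toFinset] at ha hmax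
  have haq : q < ‖a‖ := hz0q.trans_le (hmax z0 hz0)
  have ha0 : a ≠ 0 := by rintro rfl; simp at haq; linarith
  have h1 := hasMean_multiset (s.map fun z => z / a) (by
    intro z hz
    obtain ⟨y, hy, rfl⟩ := Multiset.mem_map.mp hz
    rw [norm_div]
    exact div_le_one_of_le₀ (hmax y hy) (norm_nonneg _))
  have h2 : HasMean (fun n => ((s.map fun z => z / a).map fun z => z ^ n).sum) 0 := by
    have : Tendsto (fun n : ℕ => (q / ‖a‖) ^ n) atTop (𝓝 0) :=
      tendsto_pow_atTop_nhds_zero_of_lt_one (by positivity) ((div_lt_one (by linarith)).mpr haq)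
    have h3 : HasMean (fun n => if n = 0 then 0 else
        ((s.map fun z => z / a).map fun z => z ^ n).sum) 0 := by
      refine HasMean.of_tendsto (squeeze_zero_norm (fun n => ?_) this)
      split_ifs with hn
      · simp; positivity
      · simp only [Multiset.map_map, Function.comp_def, div_pow, Multiset.sum_map_div]
        rw [norm_div, norm_pow]
        gcongr
        exact h n hn
    exact h3.congr fun n hn => by simp [hn]
  have h3 := tendsto_nhds_unique h1 h2
  have h4 : (s.map fun z => z / a).count 1 ≠ 0 := by
    rw [Multiset.count_ne_zero]
    exact Multiset.mem_map.mpr ⟨a, ha, div_self ha0⟩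
  exact h4 (by exact_mod_cast h3)

end Means
end DirPoly

namespace DirPoly
open Polynomial Filter Topology

section Main
variable {F : Type} [Field F] [Fintype F]

lemma aC_one (n : ℕ) : aC (1 : F[X] →* ℂ) n = (Fintype.card F : ℂ) ^ n := by
  simp [aC, card_MP]

lemma SC_one (n : ℕ) (hn : n ≠ 0) : SC (1 : F[X] →* ℂ) n = (Fintype.card F : ℂ) ^ n := by
  induction n using Nat.strong_induction_on with
  | _ n ih =>
    obtain ⟨k, rfl⟩ : ∃ k, n = k + 1 := ⟨n - 1, by omega⟩
    have h := recur (1 : F[X] →* ℂ) (k + 1)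
    rw [Finset.sum_range_succ, Finset.sum_range_succ', SC_zero, Nat.sub_self, aC_zero] at h
    have h1 : ∑ i ∈ Finset.range k, SC (1 : F[X] →* ℂ) (i + 1) * aC (1 : F[X] →* ℂ) (k + 1 - (i + 1)) =
        k * (Fintype.card F : ℂ) ^ (k + 1) := by
      have h2 : ∀ i ∈ Finset.range k, SC (1 : F[X] →* ℂ) (i + 1) * aC (1 : F[X] →* ℂ) (k + 1 - (i + 1)) =
          (Fintype.card F : ℂ) ^ (k + 1) := by
        intro i hi
        simp at hi
        rw [ih (i + 1) (by omega) (by omega), aC_one, ← pow_add]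
        congr 1; omega
      rw [Finset.sum_congr rfl h2]
      simp
    rw [h1, aC_one] at h
    push_cast at h
    linear_combination -h

lemma norm_SC_le (ψ : F[X] →* ℂ) (hψ : ∀ d, ‖ψ d‖ ≤ 1) (n : ℕ) (hn : n ≠ 0) :
    ‖SC ψ n‖ ≤ (Fintype.card F : ℝ) ^ n := by
  have h1 : ((Fintype.card F : ℝ) ^ n) = 
      ∑ x ∈ n.divisorsAntidiagonal, ∑ P ∈ IP F x.1, (x.1 : ℝ) := by
    have := SC_one (F := F) n hn
    simp only [SC, MonoidHom.one_apply, one_pow, mul_one] at this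
    exact_mod_cast this.symm
  rw [h1, SC]
  refine norm_sum_le_of_le _ fun x _ => norm_sum_le_of_le _ fun P _ => ?_
  rw [norm_mul, norm_pow, Complex.norm_natCast]
  exact mul_le_of_le_one_right (by positivity) (pow_le_one₀ (norm_nonneg _) (hψ P))

variable {f : F[X]} [hfi : Fact (Irreducible f)]

lemma finite_K (hfm : f.Monic) : Finite (AdjoinRoot f) := by
  have := hfm.finite_adjoinRoot
  exact Module.finite_of_finite F

/-- the completely multiplicative function of a character -/
noncomputable def psi (χ : MulChar (AdjoinRoot f) ℂ) : F[X] →* ℂ :=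
  χ.toMonoidHom.comp (AdjoinRoot.mk f : F[X] →* AdjoinRoot f)

lemma psi_apply (χ : MulChar (AdjoinRoot f) ℂ) (d : F[X]) : psi χ d = χ (AdjoinRoot.mk f d) := rfl

lemma norm_char (hfm : f.Monic) (χ : MulChar (AdjoinRoot f) ℂ) (x : AdjoinRoot f) :
    ‖χ x‖ ≤ 1 := by
  have := finite_K hfm
  have := Fintype.ofFinite (AdjoinRoot f)
  by_cases hx : x = 0
  · rw [hx, MulChar.map_zero]; simp
  · refine (Complex.norm_eq_one_of_pow_eq_one (n := Fintype.card (AdjoinRoot f) - 1) ?_ ?_).le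
    · rw [← map_pow, FiniteField.pow_card_sub_one_eq_one x hx, map_one]
    · have := Fintype.one_lt_card (α := AdjoinRoot f)
      omega

lemma aC_eq_zero (hfm : f.Monic) (χ : MulChar (AdjoinRoot f) ℂ) (hχ : χ ≠ 1) (n : ℕ)
    (hn : f.natDegree ≤ n) : aC (psi χ) n = 0 := by
  have := finite_K hfm
  have := Fintype.ofFinite (AdjoinRoot f)
  have hpos : 0 < f.natDegree := hfi.out.natDegree_pos
  have key : ∀ x : AdjoinRoot f, aC (psi χ) n = ∑ d ∈ MP F n, χ (AdjoinRoot.mk f d + x) := by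
    intro x
    obtain ⟨g0, rfl⟩ := AdjoinRoot.mk_surjective x
    set g := g0 %ₘ f with hg
    have hgx : AdjoinRoot.mk f g = AdjoinRoot.mk f g0 := by
      rw [AdjoinRoot.mk_eq_mk, hg]
      refine ⟨- (g0 /ₘ f), ?_⟩
      linear_combination (modByMonic_add_div g0 f)
    have hdeg : g.degree < n := by
      refine (degree_modByMonic_lt g0 hfm).trans_le ?_
      rw [degree_eq_natDegree hfm.ne_zero]
      exact_mod_cast hn
    have hmem : ∀ d ∈ MP F n, ∀ e : F[X], e.degree < n → d + e ∈ MP F n := by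
      intro d hd e he
      rw [mem_MP] at hd ⊢
      have h1 : e.degree < d.degree := by rw [degree_eq_natDegree hd.1.ne_zero, hd.2]; exact he
      refine ⟨hd.1.add_of_left h1, ?_⟩
      rw [natDegree_add_eq_left_of_degree_lt h1, hd.2]
    rw [aC]
    refine Finset.sum_bij' (fun d _ => d + -g) (fun d _ => d + g) ?_ ?_ ?_ ?_ ?_
    · intro d hd; exact hmem d hd _ (by rwa [degree_neg])
    · intro d hd; exact hmem d hd _ hdeg
    · intro d _; ring
    · intro d _; ring
    · intro d _
      rw [← hgx, ← map_add, psi_apply]; congr 2; ring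
  have h1 : (Fintype.card (AdjoinRoot f) : ℂ) * aC (psi χ) n = 0 := by
    calc _ = ∑ x : AdjoinRoot f, aC (psi χ) n := by simp
      _ = ∑ x : AdjoinRoot f, ∑ d ∈ MP F n, χ (AdjoinRoot.mk f d + x) :=
        Finset.sum_congr rfl fun x _ => key x
      _ = ∑ d ∈ MP F n, ∑ x : AdjoinRoot f, χ (AdjoinRoot.mk f d + x) := Finset.sum_comm
      _ = 0 := by
        refine Finset.sum_eq_zero fun d _ => ?_
        rw [← MulChar.sum_eq_zero_of_ne_one hχ]
        exact Equiv.sum_comp (Equiv.addLeft (AdjoinRoot.mk f d)) (fun x => χ x)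
  have h2 : (Fintype.card (AdjoinRoot f) : ℂ) ≠ 0 := by
    exact_mod_cast Fintype.card_ne_zero
  exact (mul_eq_zero.mp h1).resolve_left h2

lemma exists_roots (hfm : f.Monic) (χ : MulChar (AdjoinRoot f) ℂ) (hχ : χ ≠ 1) :
    ∃ s : Multiset ℂ, (∀ n ≠ 0, SC (psi χ) n = - (s.map fun α => α ^ n).sum) ∧
      ∀ α ∈ s, ‖α‖ ≤ Fintype.card F := by
  obtain ⟨s, hs⟩ := exists_powersum (aC (psi χ)) (SC (psi χ)) f.natDegree (aC_zero _)
    (fun n hn => aC_eq_zero hfm χ hχ n hn) (recur _)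
  refine ⟨s, hs, norm_le_of_powersum s _ (by exact_mod_cast Fintype.card_pos) fun n hn => ?_⟩
  rw [← norm_neg, ← hs n hn]
  exact norm_SC_le _ (fun d => norm_char hfm χ _) n hn

lemma three_four_one (hfm : f.Monic) (χ : MulChar (AdjoinRoot f) ℂ) (w : ℂ) (hw : ‖w‖ ≤ 1)
    (n : ℕ) :
    0 ≤ (3 * SC (1 : F[X] →* ℂ) n + 4 * (w ^ n * SC (psi χ) n) +
      (w ^ 2) ^ n * SC (psi (χ * χ)) n).re := by
  simp only [SC, Finset.mul_sum, ← Finset.sum_add_distrib, Complex.re_sum]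
  refine Finset.sum_nonneg fun x _ => Finset.sum_nonneg fun P _ => ?_
  set z : ℂ := w ^ n * psi χ P ^ x.2 with hz
  have hz1 : ‖z‖ ≤ 1 := by
    rw [hz, norm_mul, norm_pow, norm_pow]
    exact mul_le_one₀ (pow_le_one₀ (norm_nonneg _) hw) (by positivity)
      (pow_le_one₀ (norm_nonneg _) (norm_char hfm χ _))
  have h1 : 3 * ((x.1 : ℂ) * (1 : F[X] →* ℂ) P ^ x.2) + 4 * (w ^ n * (x.1 * psi χ P ^ x.2)) +
      (w ^ 2) ^ n * (x.1 * psi (χ * χ) P ^ x.2) = ((x.1 : ℝ) : ℂ) * (3 + 4 * z + z ^ 2) := by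
    have : psi (χ * χ) P = psi χ P ^ 2 := by
      simp only [psi_apply, MulChar.mul_apply]; ring
    rw [this, hz, MonoidHom.one_apply, one_pow]
    push_cast
    ring
  rw [h1, Complex.re_ofReal_mul]
  refine mul_nonneg (by positivity) ?_
  have h2 : z.re ^ 2 + z.im ^ 2 ≤ 1 := by
    have := Complex.sq_norm z
    rw [Complex.normSq_apply] at this
    nlinarith [norm_nonneg z]
  have h3 : (3 + 4 * z + z ^ 2).re = 3 + 4 * z.re + (z.re ^ 2 - z.im ^ 2) := by
    simp [pow_two]
  rw [h3]
  nlinarith [sq_nonneg (z.re + 1)]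

lemma card_gt : (1 : ℝ) < Fintype.card F := by
  exact_mod_cast Fintype.one_lt_card (α := F)

lemma tendsto_poly (r : ℝ) (hr : 1 < r) (k : ℕ) :
    Tendsto (fun n : ℕ => (n : ℝ) ^ k / r ^ n) atTop (𝓝 0) := by
  exact tendsto_pow_const_div_const_pow_of_one_lt k hr

lemma char_one_apply (P : F[X]) (h : ¬ f ∣ P) : psi (1 : MulChar (AdjoinRoot f) ℂ) P = 1 := by
  rw [psi_apply, MulChar.one_apply]
  rw [isUnit_iff_ne_zero]
  rwa [Ne, AdjoinRoot.mk_eq_zero]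

lemma dvd_iff_eq (hfm : f.Monic) {j : ℕ} {P : F[X]} (hP : P ∈ IP F j) : f ∣ P ↔ P = f := by
  obtain ⟨h1, h2, h3⟩ := mem_IP.mp hP
  constructor
  · intro h
    exact (eq_of_monic_of_associated hfm h1 (hfi.out.associated_of_dvd h3 h)).symm
  · rintro rfl; exact dvd_refl _

lemma trivial_tendsto (hfm : f.Monic) :
    Tendsto (fun n => SC (psi (1 : MulChar (AdjoinRoot f) ℂ)) n / (Fintype.card F : ℂ) ^ n)
      atTop (𝓝 1) := by
  classical
  have hb : ∀ n ≠ 0, ‖SC (psi (1 : MulChar (AdjoinRoot f) ℂ)) n - SC (1 : F[X] →* ℂ) n‖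
      ≤ (n : ℝ) ^ 2 := by
    intro n hn
    rw [SC, SC, ← Finset.sum_sub_distrib]
    have h1 : ∀ x ∈ n.divisorsAntidiagonal, 
        ‖∑ P ∈ IP F x.1, (x.1 : ℂ) * psi (1 : MulChar (AdjoinRoot f) ℂ) P ^ x.2 -
          ∑ P ∈ IP F x.1, (x.1 : ℂ) * (1 : F[X] →* ℂ) P ^ x.2‖ ≤ (n : ℝ) := by
      intro x hx
      have hx1 := (Nat.mem_divisorsAntidiagonal.mp hx).1
      have hx2 : x.2 ≠ 0 := by
        intro h; rw [h, mul_zero] at hx1; exact hn hx1.symm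
      have hxn : x.1 ≤ n := by
        rw [← hx1]; exact Nat.le_mul_of_pos_right _ (Nat.pos_of_ne_zero hx2)
      rw [← Finset.sum_sub_distrib]
      have h2 : ∀ P ∈ IP F x.1, ‖(x.1 : ℂ) * psi (1 : MulChar (AdjoinRoot f) ℂ) P ^ x.2 -
          (x.1 : ℂ) * (1 : F[X] →* ℂ) P ^ x.2‖ ≤ if P = f then (n : ℝ) else 0 := by
        intro P hP
        split_ifs with hPf
        · have : psi (1 : MulChar (AdjoinRoot f) ℂ) P = 0 := by
            rw [psi_apply, hPf, AdjoinRoot.mk_self, MulChar.map_zero]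
          rw [this, zero_pow hx2]
          simpa using hxn
        · rw [char_one_apply P (fun h => hPf ((dvd_iff_eq hfm hP).mp h))]
          simp
      refine (norm_sum_le_of_le _ h2).trans ?_
      rw [Finset.sum_ite_eq']
      split_ifs <;> simp
    refine (norm_sum_le_of_le _ h1).trans ?_
    rw [Finset.sum_const, nsmul_eq_mul, pow_two]
    refine mul_le_mul_of_nonneg_right ?_ (by positivity)
    rw [← Nat.map_div_right_divisors, Finset.card_map]
    exact_mod_cast Nat.card_divisors_le_self n
  have hlim : Tendsto (fun n : ℕ => SC (psi (1 : MulChar (AdjoinRoot f) ℂ)) n /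
      (Fintype.card F : ℂ) ^ n - 1) atTop (𝓝 0) := by
    refine squeeze_zero_norm' ?_ (tendsto_poly (Fintype.card F) card_gt 2)
    filter_upwards [eventually_ne_atTop 0] with n hn
    have hq : (Fintype.card F : ℂ) ^ n ≠ 0 := pow_ne_zero _ (by exact_mod_cast Fintype.card_ne_zero)
    have := hb n hn
    rw [SC_one n hn] at this
    rw [div_sub_one hq, norm_div, norm_pow, Complex.norm_natCast]
    gcongr
  simpa using hlim.add_const 1

end Main
end DirPoly

namespace DirPoly
open Polynomial Filter Topology

section Final
variable {F : Type} [Field F] [Fintype F] {f : F[X]} [hfi : Fact (Irreducible f)]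

/-- a root on the critical circle forces a quadratic situation -/
lemma quadratic_of_root (hfm : f.Monic) (χ : MulChar (AdjoinRoot f) ℂ)
    (s : Multiset ℂ) (hs : ∀ n ≠ 0, SC (psi χ) n = - (s.map fun α => α ^ n).sum)
    (hle : ∀ α ∈ s, ‖α‖ ≤ Fintype.card F) (a : ℂ) (ha : a ∈ s) (hna : ‖a‖ = Fintype.card F) :
    χ * χ = 1 ∧ ((Fintype.card F : ℂ) / a) ^ 2 = 1 := by
  classical
  set q : ℂ := (Fintype.card F : ℂ) with hq
  have hq0 : q ≠ 0 := by rw [hq]; exact_mod_cast Fintype.card_ne_zero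
  have hqn : ‖q‖ = Fintype.card F := by rw [hq, Complex.norm_natCast]
  have ha0 : a ≠ 0 := by
    intro h
    rw [h, norm_zero, ← hqn] at hna
    exact hq0 (norm_eq_zero.mp hna.symm)
  set w : ℂ := q / a with hw
  have hwn : ‖w‖ = 1 := by
    rw [hw, norm_div, hqn, hna, div_self]
    exact_mod_cast Fintype.card_ne_zero
  -- mean of the middle term
  have h1 := hasMean_multiset (s.map fun z => z / a) (by
    intro z hz
    obtain ⟨y, hy, rfl⟩ := Multiset.mem_map.mp hz
    rw [norm_div, hna]
    exact div_le_one_of_le₀ (hle y hy) (by positivity))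
  have hc : 1 ≤ (s.map fun z => z / a).count 1 := by
    rw [Multiset.one_le_count_iff_mem]
    exact Multiset.mem_map.mpr ⟨a, ha, div_self ha0⟩
  set c := (s.map fun z => z / a).count 1 with hcdef
  have hmid : HasMean (fun n => w ^ n * SC (psi χ) n / q ^ n) (-1 * c) := by
    refine (h1.const_mul (-1)).congr fun n hn => ?_
    rw [hs n hn]
    simp only [Multiset.map_map, Function.comp_def, div_pow, Multiset.sum_map_div, hw]
    have : q ^ n ≠ 0 := pow_ne_zero _ hq0
    have : a ^ n ≠ 0 := pow_ne_zero _ ha0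
    field_simp
  -- general contradiction
  have hcontra : ∀ l : ℂ, l.re ≤ 0 → 
      ¬ HasMean (fun n => (w ^ 2) ^ n * SC (psi (χ * χ)) n / q ^ n) l := by
    intro l hl hmean
    have h2 := ((hasMean_one.const_mul 3).add (hmid.const_mul 4)).add hmean
    have h3 := h2.re_nonneg (fun n hn => by
      have := three_four_one hfm χ w hwn.le n
      rw [SC_one n hn, ← hq] at this
      have h4 : 3 * 1 + 4 * (w ^ n * SC (psi χ) n / q ^ n) +
          (w ^ 2) ^ n * SC (psi (χ * χ)) n / q ^ n = 
          (((Fintype.card F : ℝ) ^ n)⁻¹ : ℝ) * (3 * q ^ n + 4 * (w ^ n * SC (psi χ) n) +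
            (w ^ 2) ^ n * SC (psi (χ * χ)) n) := by
        push_cast
        rw [← hq]
        have : q ^ n ≠ 0 := pow_ne_zero _ hq0
        field_simp
      rw [h4, Complex.re_ofReal_mul]
      exact mul_nonneg (by positivity) this)
    have hc' : (1 : ℝ) ≤ c := by exact_mod_cast hc
    simp at h3
    linarith
  by_cases hχ2 : χ * χ = 1
  · refine ⟨hχ2, ?_⟩
    by_contra hw2
    refine hcontra 0 (by simp) ?_
    have h2 := hasMean_pow (w ^ 2) (by rw [norm_pow, hwn]; simp)
    rw [if_neg hw2] at h2
    have h3 : HasMean (fun n => (w ^ 2) ^ n * (SC (psi (χ * χ)) n / q ^ n - 1)) 0 := by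
      refine HasMean.of_tendsto ?_
      rw [hχ2]
      have h4 := (trivial_tendsto hfm).sub_const 1
      rw [sub_self] at h4
      have h5 := tendsto_zero_iff_norm_tendsto_zero.mp h4
      rw [tendsto_zero_iff_norm_tendsto_zero]
      refine h5.congr fun n => ?_
      rw [norm_mul, norm_pow, norm_pow, hwn]; simp [hq]
    have h4 := h2.add h3
    rw [add_zero] at h4
    exact h4.congr fun n _ => by ring
  · exfalso
    obtain ⟨t, ht, htle⟩ := exists_roots hfm (χ * χ) hχ2
    have h2 := hasMean_multiset (t.map fun z => w ^ 2 * (z / q)) (by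
      intro z hz
      obtain ⟨y, hy, rfl⟩ := Multiset.mem_map.mp hz
      rw [norm_mul, norm_pow, hwn, norm_div, hqn, one_pow, one_mul]
      exact div_le_one_of_le₀ (htle y hy) (by positivity))
    refine hcontra _ ?_ ((h2.const_mul (-1)).congr fun n hn => ?_)
    · simp
    · rw [ht n hn]
      simp only [Multiset.map_map, Function.comp_def, mul_pow, div_pow, Multiset.sum_map_div,
        Multiset.sum_map_mul_left]
      ring

lemma exists_linear (hfm : f.Monic) : ∃ P ∈ IP F 1, ¬ f ∣ P := by
  have h0 : (X - C 0 : F[X]) ∈ IP F 1 := mem_IP.mpr ⟨monic_X_sub_C _, natDegree_X_sub_C _,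
    irreducible_X_sub_C _⟩
  have h1 : (X - C 1 : F[X]) ∈ IP F 1 := mem_IP.mpr ⟨monic_X_sub_C _, natDegree_X_sub_C _,
    irreducible_X_sub_C _⟩
  by_cases h : f ∣ X - C 0
  · refine ⟨_, h1, fun h' => ?_⟩
    rw [dvd_iff_eq hfm h0] at h
    rw [dvd_iff_eq hfm h1, ← h] at h'
    have := congrArg (eval 0) h'
    simp at this
  · exact ⟨_, h0, h⟩

open ComplexOrder in
lemma quadratic_nonneg (χ : MulChar (AdjoinRoot f) ℂ) (hχ : χ * χ = 1)
    (w : ℂ) (hw : w ^ 2 = 1) (n : ℕ) (x : ℕ × ℕ) (hx : x ∈ n.divisorsAntidiagonal) (P : F[X]) :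
    0 ≤ (x.1 : ℂ) * (1 : F[X] →* ℂ) P ^ x.2 + w ^ n * ((x.1 : ℂ) * psi χ P ^ x.2) := by
  have hx2 : x.2 ≠ 0 := by
    intro h
    have := Nat.mem_divisorsAntidiagonal.mp hx
    rw [h, mul_zero] at this
    exact this.2 this.1.symm
  set z : ℂ := w ^ n * psi χ P ^ x.2 with hz
  have h1 : (x.1 : ℂ) * (1 : F[X] →* ℂ) P ^ x.2 + w ^ n * ((x.1 : ℂ) * psi χ P ^ x.2) =
      x.1 * (1 + z) := by
    rw [MonoidHom.one_apply, one_pow, hz]; ring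
  rw [h1]
  refine mul_nonneg (by positivity) ?_
  by_cases hP : f ∣ P
  · have : psi χ P = 0 := by
      rw [psi_apply, AdjoinRoot.mk_eq_zero.mpr hP, MulChar.map_zero]
    rw [hz, this, zero_pow hx2]; simp
  · have h2 : psi χ P ^ 2 = 1 := by
      rw [← char_one_apply P hP, ← hχ, psi_apply, psi_apply, MulChar.mul_apply, pow_two]
    have h3 : z ^ 2 = 1 := by
      calc z ^ 2 = (w ^ 2) ^ n * (psi χ P ^ 2) ^ x.2 := by rw [hz]; ring
        _ = 1 := by rw [hw, h2]; simp
    rcases mul_self_eq_one_iff.mp ((pow_two z).symm.trans h3) with h | h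
    · rw [h]; norm_num
    · rw [h]; norm_num

open ComplexOrder in
/-- no roots on the critical circle -/
lemma norm_root_lt (hfm : f.Monic) (χ : MulChar (AdjoinRoot f) ℂ)
    (s : Multiset ℂ) (hs : ∀ n ≠ 0, SC (psi χ) n = - (s.map fun α => α ^ n).sum)
    (hle : ∀ α ∈ s, ‖α‖ ≤ Fintype.card F) : ∀ α ∈ s, ‖α‖ < Fintype.card F := by
  classical
  intro a ha
  refine lt_of_le_of_ne (hle a ha) fun hna => ?_
  obtain ⟨hχ2, hw2⟩ := quadratic_of_root hfm χ s hs hle a ha hna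
  set q : ℂ := (Fintype.card F : ℂ) with hq
  have hq0 : q ≠ 0 := by rw [hq]; exact_mod_cast Fintype.card_ne_zero
  set w : ℂ := q / a with hw
  have ha0 : a ≠ 0 := by
    intro h
    rw [hw, h] at hw2; simp at hw2
  have hwa : w * a = q := by rw [hw]; field_simp
  obtain ⟨t, ht⟩ := Multiset.exists_cons_of_mem ha
  have hT : ∀ n ≠ 0, SC (1 : F[X] →* ℂ) n + w ^ n * SC (psi χ) n =
      - ((t.map fun z => w * z).map fun z => z ^ n).sum := by
    intro n hn
    rw [SC_one n hn, hs n hn, ht, Multiset.map_cons, Multiset.sum_cons, ← hq, ← hwa]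
    simp only [Multiset.map_map, Function.comp_def, mul_pow, Multiset.sum_map_mul_left]
    ring
  have hexp : ∀ n, SC (1 : F[X] →* ℂ) n + w ^ n * SC (psi χ) n =
      ∑ x ∈ n.divisorsAntidiagonal, ∑ P ∈ IP F x.1,
       ((x.1 : ℂ) * (1 : F[X] →* ℂ) P ^ x.2 + w ^ n * ((x.1 : ℂ) * psi χ P ^ x.2)) := by
    intro n
    simp only [SC, Finset.mul_sum, ← Finset.sum_add_distrib]
  have hzero := powersum_nonneg (t.map fun z => w * z) (fun n hn => by
    rw [← hT n hn, hexp]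
    exact Finset.sum_nonneg fun x hx => Finset.sum_nonneg fun P _ =>
      quadratic_nonneg χ hχ2 w hw2 n x hx P)
  set n := 2 * ((t.map fun z => w * z).card + 1) with hn
  have hn0 : n ≠ 0 := by omega
  have h0 := hT n hn0
  rw [hzero n (by omega), neg_zero, hexp] at h0
  have hmem : (1, n) ∈ n.divisorsAntidiagonal := by simp [hn0]
  have h1 := (Finset.sum_eq_zero_iff_of_nonneg (fun x hx => Finset.sum_nonneg fun P _ =>
      quadratic_nonneg χ hχ2 w hw2 n x hx P)).mp h0 (1, n) hmem
  obtain ⟨P, hP, hPf⟩ := exists_linear hfm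
  have h2 := (Finset.sum_eq_zero_iff_of_nonneg (fun P _ =>
      quadratic_nonneg χ hχ2 w hw2 n (1, n) hmem P)).mp h1 P hP
  have h3 : psi χ P ^ 2 = 1 := by
    rw [← char_one_apply P hPf, ← hχ2, psi_apply, psi_apply, MulChar.mul_apply, pow_two]
  have h4 : psi χ P ^ n = 1 := by rw [hn, pow_mul, h3, one_pow]
  have h5 : w ^ n = 1 := by rw [hn, pow_mul, hw2, one_pow]
  simp only [h4, h5] at h2
  norm_num at h2

lemma nontrivial_tendsto (hfm : f.Monic) (χ : MulChar (AdjoinRoot f) ℂ) (hχ : χ ≠ 1) :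
    Tendsto (fun n => SC (psi χ) n / (Fintype.card F : ℂ) ^ n) atTop (𝓝 0) := by
  obtain ⟨s, hs, hle⟩ := exists_roots hfm χ hχ
  have hlt := norm_root_lt hfm χ s hs hle
  have hq : (0 : ℝ) < Fintype.card F := by exact_mod_cast Fintype.card_pos
  have key : ∀ t : Multiset ℂ, (∀ α ∈ t, ‖α‖ < Fintype.card F) → 
      Tendsto (fun n => (t.map fun α => α ^ n).sum / (Fintype.card F : ℂ) ^ n) atTop (𝓝 0) := by
    intro t
    induction t using Multiset.induction_on with
    | empty => intro _; simp
    | cons a t ih =>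
      intro h
      have h1 := ih fun r hr => h r (Multiset.mem_cons_of_mem hr)
      have h2 : Tendsto (fun n : ℕ => (a / (Fintype.card F : ℂ)) ^ n) atTop (𝓝 0) := by
        apply tendsto_pow_atTop_nhds_zero_of_norm_lt_one
        rw [norm_div, Complex.norm_natCast, div_lt_one hq]
        exact h a (Multiset.mem_cons_self a t)
      have h3 := h2.add h1
      rw [add_zero] at h3
      refine h3.congr fun n => ?_
      rw [Multiset.map_cons, Multiset.sum_cons, div_pow]; ring
  have h1 := (key s hlt).neg
  rw [neg_zero] at h1
  refine h1.congr' ?_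
  filter_upwards [eventually_ne_atTop 0] with n hn
  rw [hs n hn]; ring

lemma orthogonality (hfm : f.Monic) [Fintype (MulChar (AdjoinRoot f) ℂ)] (a : AdjoinRoot f)
    (ha : a ≠ 1) : ∑ χ : MulChar (AdjoinRoot f) ℂ, χ a = 0 := by
  have := finite_K hfm
  have : NeZero (Monoid.exponent (AdjoinRoot f)ˣ) := ⟨Monoid.exponent_ne_zero_of_finite⟩
  obtain ⟨χ, hχ⟩ := MulChar.exists_apply_ne_one_of_hasEnoughRootsOfUnity (AdjoinRoot f) ℂ ha
  refine eq_zero_of_mul_eq_self_left hχ ?_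
  simp only [Finset.mul_sum, ← MulChar.mul_apply]
  exact Fintype.sum_bijective _ (Group.mulLeft_bijective χ) _ _ fun χ' ↦ rfl

lemma small_terms (G : F[X] → ℕ → ℂ) (B : ℝ) (hB : 0 ≤ B) (hG : ∀ P k, ‖G P k‖ ≤ B) (n : ℕ)
    (hz : ∀ P ∈ IP F n, G P 1 = 0) :
    ‖∑ x ∈ n.divisorsAntidiagonal, ∑ P ∈ IP F x.1, (x.1 : ℂ) * G P x.2‖ ≤
      B * (n ^ 2 * (√(Fintype.card F : ℝ)) ^ n) := by
  classical
  set r := √(Fintype.card F : ℝ) with hr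
  have hr2 : r ^ 2 = Fintype.card F := Real.sq_sqrt (by positivity)
  have hr1 : 1 ≤ r := by rw [hr, Real.one_le_sqrt]; exact card_gt.le
  have h1 : ∀ x ∈ n.divisorsAntidiagonal, ‖∑ P ∈ IP F x.1, (x.1 : ℂ) * G P x.2‖ ≤
      n * B * r ^ n := by
    intro x hx
    obtain ⟨hx1, hn⟩ := Nat.mem_divisorsAntidiagonal.mp hx
    have hx2 : x.2 ≠ 0 := by
      intro h; rw [h, mul_zero] at hx1; exact hn hx1.symm
    have hxn : x.1 ≤ n := by
      rw [← hx1]; exact Nat.le_mul_of_pos_right _ (Nat.pos_of_ne_zero hx2)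
    by_cases hx3 : x.2 = 1
    · have : x.1 = n := by rw [← hx1, hx3, mul_one]
      rw [this, hx3, Finset.sum_eq_zero]
      · rw [norm_zero]; positivity
      · intro P hP; rw [hz P hP, mul_zero]
    · have hx4 : 2 * x.1 ≤ n := by
        rw [← hx1, mul_comm]; exact Nat.mul_le_mul_left _ (by omega)
      have h2 : ∀ P ∈ IP F x.1, ‖(x.1 : ℂ) * G P x.2‖ ≤ n * B := by
        intro P _
        rw [norm_mul, Complex.norm_natCast]
        have := hG P x.2
        gcongr
      refine (norm_sum_le_of_le _ h2).trans ?_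
      rw [Finset.sum_const, nsmul_eq_mul, mul_comm]
      refine mul_le_mul_of_nonneg_left ?_ (by positivity)
      calc ((IP F x.1).card : ℝ) ≤ (MP F x.1).card := by
            exact_mod_cast Finset.card_le_card (Finset.filter_subset _ _)
        _ = r ^ (2 * x.1) := by rw [card_MP, pow_mul, hr2]; push_cast; rfl
        _ ≤ r ^ n := pow_le_pow_right₀ hr1 hx4
  refine (norm_sum_le_of_le _ h1).trans ?_
  rw [Finset.sum_const, nsmul_eq_mul]
  have h3 : (n.divisorsAntidiagonal.card : ℝ) ≤ n := by
    rw [← Nat.map_div_right_divisors, Finset.card_map]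
    exact_mod_cast Nat.card_divisors_le_self n
  calc (n.divisorsAntidiagonal.card : ℝ) * (n * B * r ^ n) ≤ n * (n * B * r ^ n) := by gcongr
    _ = _ := by ring

lemma eventually_class (hfm : f.Monic) (c : AdjoinRoot f) (hc : c ≠ 0) :
    ∀ᶠ n in atTop, ∃ P ∈ IP F n, AdjoinRoot.mk f P = c := by
  classical
  have := finite_K hfm
  have : Fintype (MulChar (AdjoinRoot f) ℂ) := Fintype.ofFinite _
  set q : ℂ := (Fintype.card F : ℂ) with hq
  have hlim : Tendsto (fun n => ∑ χ : MulChar (AdjoinRoot f) ℂ, χ c⁻¹ * (SC (psi χ) n / q ^ n))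
      atTop (𝓝 (∑ χ : MulChar (AdjoinRoot f) ℂ, if χ = 1 then 1 else 0)) := by
    refine tendsto_finsetSum _ fun χ _ => ?_
    split_ifs with h
    · subst h
      have h1 : (1 : MulChar (AdjoinRoot f) ℂ) c⁻¹ = 1 :=
        MulChar.one_apply (isUnit_iff_ne_zero.mpr (inv_ne_zero hc))
      simpa [h1] using trivial_tendsto hfm
    · simpa using (nontrivial_tendsto hfm χ h).const_mul (χ c⁻¹)
  rw [Finset.sum_ite_eq' , if_pos (Finset.mem_univ _)] at hlim
  have hsmall : Tendsto (fun n : ℕ => (Fintype.card (MulChar (AdjoinRoot f) ℂ) : ℝ) *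
      ((n : ℝ) ^ 2 / (√(Fintype.card F : ℝ)) ^ n)) atTop (𝓝 0) := by
    have h1 : 1 < √(Fintype.card F : ℝ) := by
      rw [Real.lt_sqrt (by norm_num)]; simpa using card_gt (F := F)
    simpa using (tendsto_poly _ h1 2).const_mul (Fintype.card (MulChar (AdjoinRoot f) ℂ) : ℝ)
  have hn := hlim.norm
  rw [norm_one] at hn
  filter_upwards [hn.eventually (lt_mem_nhds (show (1/2 : ℝ) < 1 by norm_num)),
    hsmall.eventually (gt_mem_nhds (show (0:ℝ) < 1/2 by norm_num))] with n h1 h2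
  by_contra! hcon
  set G : F[X] → ℕ → ℂ := fun P k =>
    ∑ χ : MulChar (AdjoinRoot f) ℂ, χ (c⁻¹ * AdjoinRoot.mk f P ^ k) with hG
  have h3 : ∑ χ : MulChar (AdjoinRoot f) ℂ, χ c⁻¹ * (SC (psi χ) n / q ^ n) =
      (∑ x ∈ n.divisorsAntidiagonal, ∑ P ∈ IP F x.1, (x.1 : ℂ) * G P x.2) / q ^ n := by
    simp only [← mul_div_assoc]
    rw [← Finset.sum_div]
    congr 1
    simp only [SC, hG, Finset.mul_sum]
    rw [Finset.sum_comm]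
    refine Finset.sum_congr rfl fun x _ => ?_
    rw [Finset.sum_comm]
    refine Finset.sum_congr rfl fun P _ => Finset.sum_congr rfl fun χ _ => ?_
    rw [map_mul, map_pow, psi_apply]; ring
  have h4 := small_terms G (Fintype.card (MulChar (AdjoinRoot f) ℂ)) (by positivity) (by
      intro P k
      refine (norm_sum_le_of_le _ (fun χ _ => norm_char hfm χ _)).trans ?_
      simp) n (by
      intro P hP
      refine orthogonality hfm _ ?_
      intro h
      refine hcon P hP ?_
      rw [pow_one] at h
      field_simp at h
      exact h)
  rw [h3, norm_div, norm_pow, hq, Complex.norm_natCast] at h1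
  set r := √(Fintype.card F : ℝ) with hr
  have hr2 : r ^ 2 = Fintype.card F := Real.sq_sqrt (by positivity)
  have hr0 : 0 < r := by rw [hr, Real.sqrt_pos]; linarith [card_gt (F := F)]
  have h5 : (Fintype.card (MulChar (AdjoinRoot f) ℂ) : ℝ) * (n ^ 2 * r ^ n) /
      (Fintype.card F : ℝ) ^ n = 
      (Fintype.card (MulChar (AdjoinRoot f) ℂ) : ℝ) * ((n : ℝ) ^ 2 / r ^ n) := by
    rw [← hr2]
    field_simp
    ring
  have h6 := div_le_div_of_nonneg_right h4 (show 0 ≤ (Fintype.card F : ℝ) ^ n by positivity)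
  rw [h5] at h6
  linarith

end Final
end DirPoly

open Quaternion HahnSeries IsDedekindDomain Polynomial Multiplicative
noncomputable section

/-- Dirichlet's theorem for `F_q[t]`: for all sufficiently large `N`, every residue class
coprime to a monic irreducible `f` contains a monic irreducible polynomial of degree `N`. -/
theorem stmt6 (F : Type) [Field F] [Fintype F] (hq : Odd (Fintype.card F))
    (f : Polynomial F) (hfm : f.Monic) (hfi : Irreducible f) :
    ∃ N₀ : ℕ, ∀ N ≥ N₀, ∀ c : Polynomial F, IsCoprime c f →
      ∃ d : Polynomial F, d.Monic ∧ Irreducible d ∧ d.natDegree = N ∧ f ∣ (d - c) := by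
  have : Fact (Irreducible f) := ⟨hfi⟩
  have := DirPoly.finite_K hfm
  have h : ∀ᶠ n in Filter.atTop, ∀ c : AdjoinRoot f, c ≠ 0 →
      ∃ P ∈ DirPoly.IP F n, AdjoinRoot.mk f P = c := by
    rw [Filter.eventually_all]
    intro c
    by_cases hc : c = 0
    · simp [hc]
    · filter_upwards [DirPoly.eventually_class hfm c hc] with n hn _ using hn
  obtain ⟨N₀, hN⟩ := Filter.eventually_atTop.mp h
  refine ⟨N₀, fun N hNN c hc => ?_⟩
  obtain ⟨P, hP, hPc⟩ := hN N hNN (AdjoinRoot.mk f c) (by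
    rw [Ne, AdjoinRoot.mk_eq_zero]
    intro hd
    exact hfi.not_isUnit (hc.isUnit_of_dvd' hd dvd_rfl))
  obtain ⟨h1, h2, h3⟩ := DirPoly.mem_IP.mp hP
  exact ⟨P, h1, h3, h2, AdjoinRoot.mk_eq_mk.mp hPc⟩
end
end

section
/- Let q be an odd prime power, z ∈ F_q a nonsquare, f(t) ∈ F_q[t] monic irreducible, and d(t) ∈ F_q[t] monic irreducible of opposite degree parity to f chosen so that z·d(t) is a nonsquare mod f(t). Set a = z·f(t) and b = z·d(t). Then the Hilbert symbol (a,b)_p over F_q(t) satisfies: (a,b)_{(f)} = -1, (a,b)_{(d)} = 1, and (a,b)_q = 1 for every finite prime q of F_q[t] different from (f) and (d). -/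
open Quaternion HahnSeries IsDedekindDomain Polynomial Multiplicative
noncomputable section


/-- The quaternion algebra `H(a,b)` over `K` splits. -/
def QuatSplits (K : Type) [Field K] (a b : K) : Prop :=
  Nonempty (ℍ[K, a, b] ≃ₐ[K] Matrix (Fin 2) (Fin 2) K)

def splitBasis {K : Type} [Field K] (a b c e : K) (h : c ^ 2 - a * e ^ 2 = b) :
    QuaternionAlgebra.Basis (Matrix (Fin 2) (Fin 2) K) a 0 b where
  i := !![0, a; 1, 0]
  j := !![c, -a * e; e, -c]
  k := !![a * e, - a * c; c, - a * e]
  i_mul_i := by ext i j; fin_cases i <;> fin_cases j <;> simp [Matrix.mul_apply]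
  j_mul_j := by
    subst h
    ext i j; fin_cases i <;> fin_cases j <;> simp [Matrix.mul_apply] <;> ring
  i_mul_j := by
    ext i j; fin_cases i <;> fin_cases j <;> simp [Matrix.mul_apply]
  j_mul_i := by
    ext i j; fin_cases i <;> fin_cases j <;> simp [Matrix.mul_apply] <;> ring

theorem split_of_norm {K : Type} [Field K] (h2 : (2 : K) ≠ 0) (a b c e : K) (ha : a ≠ 0)
    (hb : b ≠ 0) (h : c ^ 2 - a * e ^ 2 = b) : QuatSplits K a b := by
  let φ : ℍ[K, a, b] →ₐ[K] Matrix (Fin 2) (Fin 2) K := (splitBasis a b c e h).liftHom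
  have hinj : Function.Injective φ := by
    rw [injective_iff_map_eq_zero]
    rintro ⟨x, y, z, w⟩ hx
    have hx' : (splitBasis a b c e h).lift ⟨x, y, z, w⟩ = 0 := hx
    have h00 := congrFun (congrFun hx' 0) 0
    have h01 := congrFun (congrFun hx' 0) 1
    have h10 := congrFun (congrFun hx' 1) 0
    have h11 := congrFun (congrFun hx' 1) 1
    simp [QuaternionAlgebra.Basis.lift, splitBasis, Matrix.algebraMap_matrix_apply] at h00 h01 h10 h11
    have e1 : x = 0 := by
      have : 2 * x = 0 := by linear_combination h00 + h11
      simpa [h2] using this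
    have e2 : y = 0 := by
      have : (2 * a) * y = 0 := by linear_combination h01 + a * h10
      simpa [h2, ha] using this
    subst e1 e2
    have e3 : z = 0 := by
      have : b * z = 0 := by rw [← h]; linear_combination c * h00 - a * e * h10
      simpa [hb] using this
    have e4 : w = 0 := by
      have : b * w = 0 := by rw [← h]; linear_combination c * h10 - e * h00
      simpa [hb] using this
    subst e3 e4
    rfl
  have hfr : Module.finrank K ℍ[K, a, b] = Module.finrank K (Matrix (Fin 2) (Fin 2) K) := by
    rw [QuaternionAlgebra.finrank_eq_four, Module.finrank_matrix]; simp
  have hsurj : Function.Surjective φ :=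
    (LinearMap.injective_iff_surjective_of_finrank_eq_finrank (f := φ.toLinearMap) hfr).1 hinj
  exact ⟨AlgEquiv.ofBijective φ ⟨hinj, hsurj⟩⟩

theorem norm_zero_of_split {K : Type} [Field K] (a b : K) (h : QuatSplits K a b) :
    ∃ x y z w : K, ¬ (x = 0 ∧ y = 0 ∧ z = 0 ∧ w = 0) ∧ x ^ 2 - b * z ^ 2 = a * (y ^ 2 - b * w ^ 2) := by
  obtain ⟨φ⟩ := h
  let N : Matrix (Fin 2) (Fin 2) K := !![0, 1; 0, 0]
  have hN : N * N = 0 := by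
    ext i j; fin_cases i <;> fin_cases j <;> simp [N, Matrix.mul_apply]
  have hN0 : N ≠ 0 := fun h => by simpa [N] using congrFun (congrFun h 0) 1
  set q := φ.symm N with hq
  have hqq : q * q = 0 := by rw [hq, ← map_mul, hN, map_zero]
  have hq0 : q ≠ 0 := by simpa [hq] using hN0
  rcases hqe : q with ⟨x, y, z, w⟩
  refine ⟨x, y, z, w, ?_, ?_⟩
  · rintro ⟨rfl, rfl, rfl, rfl⟩
    exact hq0 hqe
  · have h1 : (⟨x, -y, -z, -w⟩ : ℍ[K, a, b]) * q = ((x ^ 2 - a * y ^ 2 - b * z ^ 2 + a * b * w ^ 2 : K) : ℍ[K, a, b]) := by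
      rw [hqe]
      ext <;> simp [-QuaternionAlgebra.coe_sub, -QuaternionAlgebra.coe_add, -QuaternionAlgebra.coe_mul, -QuaternionAlgebra.coe_pow] <;> ring
    have h2 : ((x ^ 2 - a * y ^ 2 - b * z ^ 2 + a * b * w ^ 2 : K) : ℍ[K, a, b]) * q = 0 := by
      rw [← h1, mul_assoc, hqq, mul_zero]
    rw [QuaternionAlgebra.coe_mul_eq_smul, smul_eq_zero] at h2
    have := h2.resolve_right hq0
    linear_combination this

theorem norm_eq_resultant {F : Type} [Field F] [Fintype F] (g h : F[X]) (hgm : g.Monic)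
    [Fact (Irreducible g)] (n : ℕ) (hn : h.natDegree ≤ n) :
    Algebra.norm F (AdjoinRoot.mk g h) = resultant g h g.natDegree n := by
  classical
  have hg : Irreducible g := Fact.out
  have : FiniteDimensional F (AdjoinRoot g) := (AdjoinRoot.powerBasis hg.ne_zero).finite
  let E := AlgebraicClosure F
  apply (algebraMap F E).injective
  rw [Algebra.norm_eq_prod_embeddings F E, ← resultant_map_map]
  have := resultant_eq_prod_eval (g.map (algebraMap F E)) (h.map (algebraMap F E)) n
    (natDegree_map_le.trans hn) (IsAlgClosed.splits _)
  rw [natDegree_map] at this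
  rw [this, (hgm.map _).leadingCoeff, one_pow, one_mul]
  have hnd : (g.map (algebraMap F E)).roots.Nodup :=
    nodup_roots ((PerfectField.separable_of_irreducible hg).map)
  rw [← Finset.prod_mk _ hnd] 
  refine Finset.prod_bij' (fun σ _ => σ (AdjoinRoot.root g)) (fun x hx => (AdjoinRoot.equiv E F g hg.ne_zero).symm ⟨x, by simpa using hx⟩) ?_ ?_ ?_ ?_ ?_
  · intro σ _
    simp [hg.ne_zero]
  · intro x hx
    simp
  · intro σ _
    exact (AdjoinRoot.equiv E F g hg.ne_zero).symm_apply_apply σ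
  · intro x hx
    exact congrArg Subtype.val ((AdjoinRoot.equiv E F g hg.ne_zero).apply_symm_apply ⟨x, by simpa using hx⟩)
  · intro σ _
    rw [← AdjoinRoot.aeval_eq, ← aeval_algHom_apply, eval_map_algebraMap]

theorem isSquare_mk_iff {F : Type} [Field F] [Fintype F] (hq : ringChar F ≠ 2) (g h : F[X]) (hgm : g.Monic)
    [Fact (Irreducible g)] (n : ℕ) (hn : h.natDegree ≤ n) (hgh : ¬ g ∣ h) :
    IsSquare (AdjoinRoot.mk g h) ↔ IsSquare (resultant g h g.natDegree n) := by
  have hg : Irreducible g := Fact.out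
  have : FiniteDimensional F (AdjoinRoot g) := (AdjoinRoot.powerBasis hg.ne_zero).finite
  have : Finite (AdjoinRoot g) := Module.finite_of_finite F
  have : Fintype (AdjoinRoot g) := Fintype.ofFinite _
  rw [← norm_eq_resultant g h hgm n hn]
  have h0 : AdjoinRoot.mk g h ≠ 0 := by rwa [Ne, AdjoinRoot.mk_eq_zero]
  generalize AdjoinRoot.mk g h = x at *
  have hq' : ringChar (AdjoinRoot g) ≠ 2 := by
    rwa [← Algebra.ringChar_eq F]
  have hc1 := FiniteField.odd_card_of_char_ne_two hq
  have hc2 := FiniteField.odd_card_of_char_ne_two hq'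
  have hN : Algebra.norm F x ≠ 0 := by rwa [Ne, Algebra.norm_eq_zero_iff]
  rw [FiniteField.isSquare_iff hq' h0, FiniteField.isSquare_iff hq hN,
    ← (algebraMap F (AdjoinRoot g)).injective.eq_iff, map_pow, FiniteField.algebraMap_norm_eq_pow, ← pow_mul, map_one]
  have : (Nat.card (AdjoinRoot g) - 1) / (Nat.card F - 1) * (Fintype.card F / 2) = Fintype.card (AdjoinRoot g) / 2 := by
    have hd : Fintype.card F - 1 ∣ Fintype.card (AdjoinRoot g) - 1 := by
      rw [Module.card_eq_pow_finrank (K := F) (V := AdjoinRoot g)]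
      simpa using Nat.sub_dvd_pow_sub_pow (Fintype.card F) 1 (Module.finrank F (AdjoinRoot g))
    rw [Nat.card_eq_fintype_card, Nat.card_eq_fintype_card]
    obtain ⟨k, hk⟩ := hd
    have h1 : 1 < Fintype.card F := Fintype.one_lt_card
    rw [hk, Nat.mul_div_cancel_left _ (by omega)]
    obtain ⟨m, hm⟩ : ∃ m, Fintype.card F = 2 * m + 1 := ⟨Fintype.card F / 2, by omega⟩
    have : Fintype.card (AdjoinRoot g) = 2 * (k * m) + 1 := by
      have : 0 < Fintype.card (AdjoinRoot g) := Fintype.card_pos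
      rw [hm] at hk
      simp at hk
      rw [show 2 * (k * m) = 2 * m * k by ring]
      omega
    rw [this, hm]
    rw [show (2 * m + 1) / 2 = m by omega]; omega
  rw [this]

theorem recip {F : Type} [Field F] [Fintype F] (hq : ringChar F ≠ 2) (z : F) (hz : ¬ IsSquare z)
    (f d : Polynomial F) (hfm : f.Monic) (hfi : Irreducible f)
    (hdm : d.Monic) (hdi : Irreducible d)
    (hpar : Even f.natDegree ↔ Odd d.natDegree) (hfd : f ≠ d)
    (hzd : ¬ IsSquare (Ideal.Quotient.mk (Ideal.span {f}) (Polynomial.C z * d))) :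
    IsSquare (Ideal.Quotient.mk (Ideal.span {d}) (Polynomial.C z * f)) := by
  classical
  have := Fact.mk hfi
  have := Fact.mk hdi
  have hz0 : z ≠ 0 := by rintro rfl; exact hz (by simp)
  have key : ∀ g h : F[X], Irreducible g → Irreducible h → g.Monic → h.Monic → g ≠ h → ¬ g ∣ Polynomial.C z * h := by
    intro g h hg hh hgm hhm hne hdvd
    have hu : IsUnit (Polynomial.C z) := isUnit_C.2 (isUnit_iff_ne_zero.2 hz0)
    rw [hu.dvd_mul_left] at hdvd
    exact hne (eq_of_monic_of_associated hgm hhm (hg.associated_of_dvd hh hdvd))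
  change ¬ IsSquare (AdjoinRoot.mk f (Polynomial.C z * d)) at hzd
  change IsSquare (AdjoinRoot.mk d (Polynomial.C z * f))
  rw [isSquare_mk_iff hq f _ hfm d.natDegree (natDegree_C_mul_le _ _) (key f d hfi hdi hfm hdm hfd),
    resultant_C_mul_right] at hzd
  rw [isSquare_mk_iff hq d _ hdm f.natDegree (natDegree_C_mul_le _ _) (key d f hdi hfi hdm hfm hfd.symm),
    resultant_C_mul_right]
  have hcop : IsCoprime f d := (hfi.coprime_iff_not_dvd).2 fun h => key f d hfi hdi hfm hdm hfd (h.mul_left _)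
  have hev : Even (d.natDegree * f.natDegree) := by grind
  rw [resultant_comm d f, hev.neg_one_pow, one_mul]
  have hr0 : resultant f d ≠ 0 := resultant_ne_zero _ _ hcop
  generalize resultant f d = r at *
  have hzq := (quadraticChar_neg_one_iff_not_isSquare).2 hz
  rw [← quadraticChar_neg_one_iff_not_isSquare, map_mul, map_pow, hzq] at hzd
  have hne : z ^ d.natDegree * r ≠ 0 := mul_ne_zero (pow_ne_zero _ hz0) hr0
  rw [← quadraticChar_one_iff_isSquare hne, map_mul, map_pow, hzq]
  rcases Nat.even_or_odd f.natDegree with h | h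
  · rw [h.neg_one_pow] at hzd
    rw [(hpar.1 h).neg_one_pow]; linarith
  · rw [h.neg_one_pow] at hzd
    have : Even d.natDegree := by grind
    rw [this.neg_one_pow]; linarith

section loc
variable {R : Type} [CommRing R] [IsDedekindDomain R] {K : Type} [Field K] [Algebra R K]
  [IsFractionRing R K] (p : HeightOneSpectrum R)

theorem val_coe (k : K) : Valued.v (algebraMap K (p.adicCompletion K) k) = p.valuation K k :=
  HeightOneSpectrum.valuedAdicCompletion_eq_valuation' p k

theorem val_int (r : R) :
    Valued.v (algebraMap K (p.adicCompletion K) (algebraMap R K r)) = p.intValuation r := by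
  rw [val_coe, HeightOneSpectrum.valuation_of_algebraMap]

theorem mem_nhds_zero_iff (s : Set (p.adicCompletion K)) (hs : s ∈ nhds (0 : p.adicCompletion K)) :
    ∃ n : ℕ, ∀ x : p.adicCompletion K, Valued.v x ≤ WithZero.exp (-(n : ℤ)) → x ∈ s := by
  obtain ⟨γ, hγ⟩ := Valued.mem_nhds_zero.1 hs
  have h0 : MonoidWithZeroHom.ValueGroup₀.embedding γ.val ≠ 0 := by
    intro h
    rw [map_eq_zero] at h
    exact γ.ne_zero h
  obtain ⟨n, hn⟩ := WithZero.exists_exp_neg_natCast_lt h0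
  refine ⟨n, fun x hx => hγ ?_⟩
  rw [Set.mem_ofPred_eq]
  apply MonoidWithZeroHom.ValueGroup₀.embedding_strictMono.lt_iff_lt.1
  rw [Valuation.embedding_restrict]
  exact hx.trans_lt hn

theorem nonarch : NonarchimedeanAddGroup (p.adicCompletion K) where
  is_nonarchimedean U hU := by
    obtain ⟨γ, hγ⟩ := Valued.mem_nhds_zero.1 hU
    exact ⟨⟨Valued.v.restrict.ltAddSubgroup γ, Valued.isOpen_ball _ γ.val⟩, hγ⟩

theorem tendsto_zero (x : ℕ → R) (hx : ∀ n, x n ∈ p.asIdeal ^ n) :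
    Filter.Tendsto (fun n => algebraMap K (p.adicCompletion K) (algebraMap R K (x n)))
      Filter.atTop (nhds 0) := by
  intro s hs
  obtain ⟨n, hn⟩ := mem_nhds_zero_iff p s hs
  rw [Filter.mem_map]
  filter_upwards [Filter.eventually_ge_atTop n] with m hm
  apply hn
  rw [val_int, HeightOneSpectrum.intValuation_le_pow_iff_mem]
  exact Ideal.pow_le_pow_right hm (hx m)

theorem isSquare_of_mod (u s t : R) (hu : s ^ 2 - u ∈ p.asIdeal) (ht : 1 - 2 * s * t ∈ p.asIdeal) :
    IsSquare (algebraMap K (p.adicCompletion K) (algebraMap R K u)) := by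
  let S : ℕ → R := fun n => Nat.rec s (fun _ x => x - t * (x ^ 2 - u)) n
  have hS : ∀ n, S (n + 1) = S n - t * (S n ^ 2 - u) := fun n => rfl
  have key : ∀ n, S n ^ 2 - u ∈ p.asIdeal ^ (n + 1) ∧ S n - s ∈ p.asIdeal := by
    intro n
    induction n with
    | zero => simpa [S] using hu
    | succ n ih =>
      obtain ⟨h1, h2⟩ := ih
      have h1' : S n ^ 2 - u ∈ p.asIdeal := Ideal.pow_le_self (by omega) h1
      constructor
      · rw [hS, show (S n - t * (S n ^ 2 - u)) ^ 2 - u =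
          (S n ^ 2 - u) * ((1 - 2 * s * t) - 2 * t * (S n - s) + t ^ 2 * (S n ^ 2 - u)) by ring, pow_succ]
        exact Ideal.mul_mem_mul h1 (add_mem (sub_mem ht (Ideal.mul_mem_left _ _ h2)) (Ideal.mul_mem_left _ _ h1'))
      · rw [hS, show S n - t * (S n ^ 2 - u) - s = (S n - s) - t * (S n ^ 2 - u) by ring]
        exact sub_mem h2 (Ideal.mul_mem_left _ _ h1')
  have := nonarch (K := K) p
  let ι : R →+* p.adicCompletion K := (algebraMap K (p.adicCompletion K)).comp (algebraMap R K)
  have hc : CauchySeq fun n => ι (S n) := by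
    apply NonarchimedeanAddGroup.cauchySeq_of_tendsto_sub_nhds_zero
    simp_rw [← map_sub]
    apply tendsto_zero p
    intro n
    rw [hS, sub_sub_cancel_left, neg_mem_iff]
    exact Ideal.mul_mem_left _ _ (Ideal.pow_le_pow_right (by omega) (key n).1)
  obtain ⟨l, hl⟩ := cauchySeq_tendsto_of_complete hc
  have h1 : Filter.Tendsto (fun n => ι (S n ^ 2 - u)) Filter.atTop (nhds 0) :=
    tendsto_zero p _ fun n => Ideal.pow_le_pow_right (by omega) (key n).1
  have h2 : Filter.Tendsto (fun n => ι (S n ^ 2 - u)) Filter.atTop (nhds (l ^ 2 - ι u)) := by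
    simp_rw [map_sub, map_pow]
    exact (hl.pow 2).sub_const _
  have h3 := tendsto_nhds_unique h1 h2
  exact ⟨l, by change ι u = _; linear_combination h3⟩

theorem exists_approx (u : p.adicCompletion K) (hu : Valued.v u ≤ 1) :
    ∃ r : R, Valued.v (algebraMap K (p.adicCompletion K) (algebraMap R K r) - u) < 1 := by
  have hopen : {y : p.adicCompletion K | Valued.v (y - u) < 1} ∈ nhds u := by
    rw [Valued.mem_nhds]
    refine ⟨1, fun y hy => ?_⟩
    simpa using hy
  obtain ⟨k, hk⟩ := (HeightOneSpectrum.denseRange_algebraMap K p).exists_mem_open isOpen_interior ⟨u, mem_interior_iff_mem_nhds.2 hopen⟩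
  have hk := interior_subset hk
  rw [Set.mem_ofPred_eq] at hk
  have hk1 : p.valuation K k ≤ 1 := by
    rw [← val_coe, show algebraMap K (p.adicCompletion K) k = (algebraMap K (p.adicCompletion K) k - u) + u by ring]
    exact (Valuation.map_add _ _ _).trans (max_le hk.le hu)
  obtain ⟨r, hr⟩ := HeightOneSpectrum.exists_valuation_sub_lt_of_integer p hk1 1
  refine ⟨r, ?_⟩
  rw [← val_coe, map_sub] at hr
  rw [show algebraMap K (p.adicCompletion K) (algebraMap R K r) - u =
    (algebraMap K (p.adicCompletion K) (algebraMap R K r) - algebraMap K (p.adicCompletion K) k) + (algebraMap K (p.adicCompletion K) k - u) by ring]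
  exact (Valuation.map_add _ _ _).trans_lt (max_lt (by simpa using hr) hk)

theorem val_norm (b : R) (hb : ∀ r : R, r ^ 2 - b ∉ p.asIdeal) (x y : p.adicCompletion K) :
    Valued.v (x ^ 2 - algebraMap K (p.adicCompletion K) (algebraMap R K b) * y ^ 2) =
      (max (Valued.v x) (Valued.v y)) ^ 2 := by
  have hbp : b ∉ p.asIdeal := fun h => hb 0 (by simpa using h)
  set β := algebraMap K (p.adicCompletion K) (algebraMap R K b) with hβ
  have hvb : Valued.v β = 1 := by
    rw [hβ, val_int]; exact HeightOneSpectrum.intValuation_eq_one_iff.2 hbp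
  have hvy : Valued.v (-(β * y ^ 2)) = Valued.v y ^ 2 := by
    rw [Valuation.map_neg, map_mul, hvb, one_mul, map_pow]
  by_cases hxy : Valued.v x = Valued.v y
  · rw [hxy, max_self]
    by_cases hy : y = 0
    · subst hy
      have : x = 0 := by simpa using hxy
      simp [this]
    have hv0 : (Valued.v y) ≠ 0 := by simpa using hy
    have hu : Valued.v (x / y) = 1 := by rw [map_div₀, hxy, div_self hv0]
    have e : x ^ 2 - β * y ^ 2 = ((x / y) ^ 2 - β) * y ^ 2 := by field_simp
    rw [e, map_mul, map_pow Valued.v y]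
    suffices Valued.v ((x / y) ^ 2 - β) = 1 by rw [this, one_mul]
    set u := x / y
    apply le_antisymm
    · refine (Valuation.map_sub _ _ _).trans (max_le ?_ hvb.le)
      rw [map_pow, hu, one_pow]
    · by_contra! hlt
      obtain ⟨r, hr⟩ := exists_approx p u hu.le
      apply hb r
      rw [← HeightOneSpectrum.intValuation_lt_one_iff_mem, ← val_int (K := K), map_sub, map_sub, map_pow, map_pow]
      set ρ := algebraMap K (p.adicCompletion K) (algebraMap R K r) with hρ
      have hρ1 : Valued.v ρ ≤ 1 := by rw [hρ, val_int]; exact p.intValuation_le_one r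
      rw [← hβ, show ρ ^ 2 - β = (ρ - u) * (ρ + u) + (u ^ 2 - β) by ring]
      refine (Valuation.map_add _ _ _).trans_lt (max_lt ?_ hlt)
      rw [map_mul]
      exact mul_lt_one_of_lt_of_le hr ((Valuation.map_add _ _ _).trans (max_le hρ1 hu.le))
  · rw [sub_eq_add_neg, Valuation.map_add_of_distinct_val _ (by
      rw [hvy, map_pow]
      intro h
      exact hxy ((pow_left_inj₀ zero_le zero_le two_ne_zero).1 h)), hvy, map_pow]
    exact ((pow_left_mono 2).map_max).symm

theorem no_zero (b : R) (hb : ∀ r : R, r ^ 2 - b ∉ p.asIdeal) (a : p.adicCompletion K)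
    (ha : Valued.v a = WithZero.exp (-1 : ℤ)) (x y z w : p.adicCompletion K)
    (h : x ^ 2 - algebraMap K (p.adicCompletion K) (algebraMap R K b) * z ^ 2 =
      a * (y ^ 2 - algebraMap K (p.adicCompletion K) (algebraMap R K b) * w ^ 2)) :
    x = 0 ∧ y = 0 ∧ z = 0 ∧ w = 0 := by
  have h' := congrArg Valued.v h
  rw [map_mul, val_norm p b hb, val_norm p b hb, ha] at h'
  by_cases hM : max (Valued.v y) (Valued.v w) = 0
  · rw [hM] at h'
    have hM' : max (Valued.v x) (Valued.v z) = 0 := by simpa using h'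
    have k : ∀ s t : p.adicCompletion K, max (Valued.v s) (Valued.v t) = 0 → s = 0 ∧ t = 0 := by
      intro s t hst
      constructor
      · have := (le_max_left (Valued.v s) (Valued.v t)).trans hst.le
        simpa using this
      · have := (le_max_right (Valued.v s) (Valued.v t)).trans hst.le
        simpa using this
    exact ⟨(k _ _ hM').1, (k _ _ hM).1, (k _ _ hM').2, (k _ _ hM).2⟩
  · exfalso
    have := congrArg WithZero.log h'
    rw [WithZero.log_mul (by simp) (pow_ne_zero _ hM), WithZero.log_pow, WithZero.log_pow, WithZero.log_exp] at this
    simp only [nsmul_eq_mul, Nat.cast_ofNat] at this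
    omega
end loc

theorem split_sq {K : Type} [Field K] (h2 : (2 : K) ≠ 0) (a b : K) (ha : a ≠ 0)
    (hb : b ≠ 0) (h : IsSquare a) : QuatSplits K a b := by
  obtain ⟨s, rfl⟩ := h
  have hs : s ≠ 0 := by rintro rfl; simp at ha
  refine split_of_norm h2 _ b ((b + 1) / 2) ((b - 1) / (2 * s)) ha hb ?_
  field_simp
  ring

theorem two_inv_mod {F : Type} [Field F] (h2 : (2 : F) ≠ 0) (p : HeightOneSpectrum F[X]) (s : F[X])
    (hs : s ∉ p.asIdeal) : ∃ t, 1 - 2 * s * t ∈ p.asIdeal := by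
  have hmax := p.isMaximal
  have hs2 : 2 * s ∉ p.asIdeal := by
    intro h
    apply hs
    have := p.asIdeal.mul_mem_left (Polynomial.C (2 : F)⁻¹) h
    rwa [← mul_assoc, show (2 : F[X]) = Polynomial.C (2 : F) from (map_ofNat Polynomial.C 2).symm, ← C_mul,
      inv_mul_cancel₀ h2, C_1, one_mul] at this
  obtain ⟨y, i, hi, h⟩ := hmax.exists_inv hs2
  exact ⟨y, by rw [show 1 - 2 * s * y = i by linear_combination -h]; exact hi⟩

theorem isSquare_poly {F : Type} [Field F] (h2 : (2 : F) ≠ 0) (p : HeightOneSpectrum F[X])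
    (u s : F[X]) (hu : u ∉ p.asIdeal) (hs : s ^ 2 - u ∈ p.asIdeal) :
    IsSquare (algebraMap (RatFunc F) (p.adicCompletion (RatFunc F)) (algebraMap F[X] (RatFunc F) u)) := by
  have hsp : s ∉ p.asIdeal := fun h => hu (by
    have := sub_mem (p.asIdeal.mul_mem_left s h) hs
    rwa [show s * s - (s ^ 2 - u) = u by ring] at this)
  obtain ⟨t, ht⟩ := two_inv_mod h2 p s hsp
  exact isSquare_of_mod p u s t hs ht

theorem split_units {F : Type} [Field F] [Fintype F] (hq : ringChar F ≠ 2) (p : HeightOneSpectrum F[X])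
    (a b : F[X]) (ha : a ∉ p.asIdeal) (hb : b ∉ p.asIdeal) :
    ∃ x y : F[X], a * x ^ 2 + b * y ^ 2 - 1 ∈ p.asIdeal := by
  have hmax := p.isMaximal
  let k := F[X] ⧸ p.asIdeal
  let : Field k := Ideal.Quotient.field _
  obtain ⟨g, hg⟩ := (IsPrincipalIdealRing.principal p.asIdeal)
  have hg' : p.asIdeal = Ideal.span {g} := hg
  have hg0 : g ≠ 0 := by
    rintro rfl
    exact p.ne_bot (by simpa using hg')
  have hfin : Finite k := by
    have : Module.Finite F (AdjoinRoot g) := (AdjoinRoot.powerBasis hg0).finite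
    have : Finite (AdjoinRoot g) := Module.finite_of_finite F
    have h3 : Finite (F[X] ⧸ Ideal.span {g}) := this
    rw [← hg'] at h3
    exact h3
  let : Fintype k := Fintype.ofFinite _
  have hq' : ringChar k ≠ 2 := by rwa [← Algebra.ringChar_eq F]
  have ha0 : (Ideal.Quotient.mk p.asIdeal a : k) ≠ 0 := by rwa [Ne, Ideal.Quotient.eq_zero_iff_mem]
  have hb0 : (Ideal.Quotient.mk p.asIdeal b : k) ≠ 0 := by rwa [Ne, Ideal.Quotient.eq_zero_iff_mem]
  obtain ⟨x, y, hxy⟩ := FiniteField.exists_root_sum_quadratic (R := k)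
    (f := Polynomial.C (Ideal.Quotient.mk p.asIdeal a : k) * X ^ 2 + Polynomial.C 0 * X + Polynomial.C (-1))
    (g := Polynomial.C (Ideal.Quotient.mk p.asIdeal b : k) * X ^ 2 + Polynomial.C 0 * X + Polynomial.C 0)
    (degree_quadratic ha0) (degree_quadratic hb0) (FiniteField.odd_card_of_char_ne_two hq')
  obtain ⟨x, rfl⟩ := Ideal.Quotient.mk_surjective x
  obtain ⟨y, rfl⟩ := Ideal.Quotient.mk_surjective y
  refine ⟨x, y, ?_⟩
  rw [← Ideal.Quotient.eq_zero_iff_mem]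
  simp only [map_sub, map_add, map_mul, map_pow, map_one]
  simp only [eval_add, eval_mul, eval_C, eval_pow, eval_X] at hxy
  linear_combination hxy

/-- With `z` a nonsquare constant, `f, d` monic irreducible of opposite degree parity and
`z·d` a nonsquare mod `f`, setting `a = z·f`, `b = z·d`, the Hilbert symbol of `(a,b)`
at finite primes of `F_q(t)` is `-1` at `(f)`, `1` at `(d)`, and `1` elsewhere. -/
theorem stmt9 (F : Type) [Field F] [Fintype F] (hq : Odd (Fintype.card F))
    (z : F) (hz : ¬ IsSquare z)
    (f d : Polynomial F) (hfm : f.Monic) (hfi : Irreducible f)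
    (hdm : d.Monic) (hdi : Irreducible d)
    (hpar : Even f.natDegree ↔ Odd d.natDegree)
    (hzd : ¬ IsSquare (Ideal.Quotient.mk (Ideal.span {f}) (C z * d)))
    (a b : RatFunc F)
    (ha : a = algebraMap (Polynomial F) (RatFunc F) (C z * f))
    (hb : b = algebraMap (Polynomial F) (RatFunc F) (C z * d)) :
    ∀ p : HeightOneSpectrum (Polynomial F),
      (p.asIdeal = Ideal.span {f} →
        ¬ QuatSplits (p.adicCompletion (RatFunc F))
          (algebraMap (RatFunc F) (p.adicCompletion (RatFunc F)) a)
          (algebraMap (RatFunc F) (p.adicCompletion (RatFunc F)) b)) ∧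
      (p.asIdeal = Ideal.span {d} →
        QuatSplits (p.adicCompletion (RatFunc F))
          (algebraMap (RatFunc F) (p.adicCompletion (RatFunc F)) a)
          (algebraMap (RatFunc F) (p.adicCompletion (RatFunc F)) b)) ∧
      (p.asIdeal ≠ Ideal.span {f} → p.asIdeal ≠ Ideal.span {d} →
        QuatSplits (p.adicCompletion (RatFunc F))
          (algebraMap (RatFunc F) (p.adicCompletion (RatFunc F)) a)
          (algebraMap (RatFunc F) (p.adicCompletion (RatFunc F)) b)) := by
  have hq2 : ringChar F ≠ 2 := by
    intro h
    have := FiniteField.even_card_of_char_two h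
    obtain ⟨m, hm⟩ := hq
    omega
  have h2 : (2 : F) ≠ 0 := Ring.two_ne_zero hq2
  have hz0 : z ≠ 0 := by rintro rfl; exact hz (by simp)
  have hzu : IsUnit (Polynomial.C z) := isUnit_C.2 (isUnit_iff_ne_zero.2 hz0)
  have hfd : f ≠ d := by
    rintro rfl
    apply hzd
    rw [Ideal.Quotient.eq_zero_iff_mem.2 (Ideal.mul_mem_left _ _ (Ideal.mem_span_singleton_self f))]
    exact IsSquare.zero
  have hnd : ∀ g h : F[X], Irreducible g → Irreducible h → g.Monic → h.Monic → g ≠ h →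
      Polynomial.C z * h ∉ Ideal.span {g} := by
    intro g h hg hh hgm hhm hne hmem
    rw [Ideal.mem_span_singleton, hzu.dvd_mul_left] at hmem
    exact hne (eq_of_monic_of_associated hgm hhm (hg.associated_of_dvd hh hmem))
  have hoth : ∀ (p : HeightOneSpectrum F[X]) (g : F[X]), Irreducible g → p.asIdeal ≠ Ideal.span {g} →
      Polynomial.C z * g ∉ p.asIdeal := by
    intro p g hg hne hmem
    have hgm : g ∈ p.asIdeal := (p.isPrime.mem_or_mem hmem).resolve_left
      fun h => p.isPrime.ne_top (Ideal.eq_top_of_isUnit_mem _ h hzu)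
    have hmax : (Ideal.span {g}).IsMaximal := PrincipalIdealRing.isMaximal_of_irreducible hg
    exact hne (hmax.eq_of_le p.isPrime.ne_top ((Ideal.span_singleton_le_iff_mem _).2 hgm)).symm
  subst ha hb
  intro p
  have inj : Function.Injective fun r : F[X] =>
      algebraMap (RatFunc F) (p.adicCompletion (RatFunc F)) (algebraMap F[X] (RatFunc F) r) :=
    (algebraMap (RatFunc F) (p.adicCompletion (RatFunc F))).injective.comp
      (IsFractionRing.injective F[X] (RatFunc F))
  have hne0 : ∀ r : F[X], r ≠ 0 →
      algebraMap (RatFunc F) (p.adicCompletion (RatFunc F)) (algebraMap F[X] (RatFunc F) r) ≠ 0 := by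
    intro r hr h
    exact hr (inj (by simpa using h))
  have h2K : (2 : p.adicCompletion (RatFunc F)) ≠ 0 := by
    have h2p : (2 : F[X]) ≠ 0 := by
      rw [show (2 : F[X]) = Polynomial.C (2 : F) from (map_ofNat Polynomial.C 2).symm]
      simpa using h2
    have h := hne0 2 h2p
    rwa [map_ofNat, map_ofNat] at h
  have ha0 := hne0 (Polynomial.C z * f) (mul_ne_zero hzu.ne_zero hfi.ne_zero)
  have hb0 := hne0 (Polynomial.C z * d) (mul_ne_zero hzu.ne_zero hdi.ne_zero)
  refine ⟨fun hp hs => ?_, fun hp => ?_, fun hpf hpd => ?_⟩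
  · obtain ⟨x, y, z', w, hnz, heq⟩ := norm_zero_of_split _ _ hs
    refine hnz (no_zero p (Polynomial.C z * d) ?_ _ ?_ x y z' w heq)
    · intro r hr
      apply hzd
      rw [hp, ← Ideal.Quotient.eq_zero_iff_mem, map_sub, map_pow, sub_eq_zero] at hr
      exact ⟨_, by rw [← hr, sq]⟩
    · rw [val_int]
      refine HeightOneSpectrum.intValuation_singleton p (mul_ne_zero hzu.ne_zero hfi.ne_zero) ?_
      rw [hp, Ideal.span_singleton_mul_left_unit hzu]
  · obtain ⟨s, hs⟩ := recip hq2 z hz f d hfm hfi hdm hdi hpar hfd hzd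
    obtain ⟨s, rfl⟩ := Ideal.Quotient.mk_surjective s
    refine split_sq h2K _ _ ha0 hb0 (isSquare_poly h2 p _ s ?_ ?_)
    · rw [hp]
      exact hnd d f hdi hfi hdm hfm hfd.symm
    · rw [hp, ← Ideal.Quotient.eq_zero_iff_mem, map_sub, hs, map_pow, sq, sub_self]
  · have hA := hoth p f hfi hpf
    have hB := hoth p d hdi hpd
    obtain ⟨x, y, hxy⟩ := split_units hq2 p _ _ hA hB
    generalize Polynomial.C z * f = A at *
    generalize Polynomial.C z * d = B at *
    by_cases hy : y ∈ p.asIdeal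
    · -- then `A * x ^ 2` is congruent to `1`, so `A` is a square
      refine split_sq h2K _ _ ha0 hb0 (isSquare_poly h2 p _ (A * x) hA ?_)
      rw [show (A * x) ^ 2 - A = A * ((A * x ^ 2 + B * y ^ 2 - 1) - B * y * y) by ring]
      exact Ideal.mul_mem_left _ _ (sub_mem hxy (Ideal.mul_mem_left _ _ hy))
    · have hu : B * (1 - A * x ^ 2) ∉ p.asIdeal := by
        intro h
        have h1 : B * B * (y * y) ∈ p.asIdeal := by
          rw [show B * B * (y * y) = B * (A * x ^ 2 + B * y ^ 2 - 1) + B * (1 - A * x ^ 2) by ring]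
          exact add_mem (Ideal.mul_mem_left _ _ hxy) h
        rcases p.isPrime.mem_or_mem h1 with h | h
        · exact (p.isPrime.mem_or_mem h).elim hB hB
        · exact (p.isPrime.mem_or_mem h).elim hy hy
      obtain ⟨s, hs⟩ := isSquare_poly h2 p (B * (1 - A * x ^ 2)) (B * y) hu (by
        rw [show (B * y) ^ 2 - B * (1 - A * x ^ 2) = B * (A * x ^ 2 + B * y ^ 2 - 1) by ring]
        exact Ideal.mul_mem_left _ _ hxy)
      have hs0 : s ≠ 0 := by
        rintro rfl
        refine hne0 _ ?_ (hs.trans (mul_zero 0))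
        rintro h0
        exact hu (by rw [h0]; exact zero_mem _)
      simp only [map_mul, map_sub, map_one, map_pow] at hs
      generalize algebraMap (RatFunc F) (p.adicCompletion (RatFunc F)) (algebraMap F[X] (RatFunc F) A) = α at *
      generalize algebraMap (RatFunc F) (p.adicCompletion (RatFunc F)) (algebraMap F[X] (RatFunc F) B) = β at *
      generalize algebraMap (RatFunc F) (p.adicCompletion (RatFunc F)) (algebraMap F[X] (RatFunc F) x) = ξ at *
      refine split_of_norm h2K α β (β / s) (β * ξ / s) ha0 hb0 ?_
      field_simp
      linear_combination hs
end
end
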